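/- arXiv:1905.05978 — 2 statements merged into one kernel-verified Lean document; each statement's English description precedes it below -/
import Mathlib

section
/- For N sufficiently large, any ε_N ∈ [(log log N)^{-1/10}, 1), and any δ ∈ (0,1), there exists an admissible tuple (x_1,…,x_k) ∈ Σ_N^k whose underlying set {x_1,…,x_k} is a (1−δ)-boosting set at parameter p*, with cardinality k ≤ exp(10^{15} (δ ε_N)^{-2} (log log N)^{1/5}). -/
open scoped Classical

noncomputable section


/-- A point of the discrete cube `Σ_N = {-1,1}^N`, encoded by booleans
(`true ↦ +1`, `false ↦ -1`). -/
abbrev Cube (N : ℕ) := Fin N → Bool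

/-- The `±1` value encoded by a boolean. -/
def pmVal (b : Bool) : ℝ := if b then 1 else -1

/-- The inner product `x · y = ∑ i x^i y^i` on `Σ_N`. -/
def cubeDot {N : ℕ} (x y : Cube N) : ℝ := ∑ i, pmVal (x i) * pmVal (y i)

/-- The half cube `H(x) := {y ∈ Σ_N : x · y ≥ κ √N}`. -/
def halfCube {N : ℕ} (κ : ℝ) (x : Cube N) : Set (Cube N) :=
  {y | cubeDot x y ≥ κ * Real.sqrt N}

/-- Bernoulli(p) product weight of a configuration `ω : Σ_N → {0,1}`. -/
def bWeight {N : ℕ} (p : ℝ) (ω : Cube N → Bool) : ℝ :=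
  p ^ (Finset.univ.filter fun x => ω x = true).card *
    (1 - p) ^ (Finset.univ.filter fun x => ω x = false).card

/-- The product Bernoulli measure `ℙ_p` of an event `E ⊆ {0,1}^{Σ_N}`. -/
def bernoulliP {N : ℕ} (p : ℝ) (E : Set (Cube N → Bool)) : ℝ :=
  ∑ ω : Cube N → Bool, if ω ∈ E then bWeight p ω else 0

/-- The event `E = {⋂_{x : ω_x = 1} H(x) = ∅}`. -/
def emptyInter {N : ℕ} (κ : ℝ) : Set (Cube N → Bool) :=
  {ω | (⋂ x ∈ {x : Cube N | ω x = true}, halfCube κ x) = (∅ : Set (Cube N))}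

/-- The total influence `I(p)` of the indicator of the event `E` as a boolean
function of `(ω_x)_{x ∈ Σ_N}`: `I(p) = ∑_x ℙ_p(1_E(ω) ≠ 1_E(ω^{(x)}))`, where
`ω^{(x)}` resamples coordinate `x` independently. -/
def influence {N : ℕ} (κ p : ℝ) : ℝ :=
  ∑ x : Cube N, ∑ ω : Cube N → Bool, ∑ b : Bool,
    bWeight p ω * (if b then p else 1 - p) *
      (if (ω ∈ emptyInter κ ↔ Function.update ω x b ∈ emptyInter κ) then 0 else 1)

/-- `p* := inf {p ≥ p_N(ε_N) : I(p) ≤ 8 (log log N)^{1/10}}`. -/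
def pStar {N : ℕ} (κ pN : ℝ) : ℝ :=
  sInf {p : ℝ | pN ≤ p ∧ influence (N := N) κ p ≤ 8 * Real.log (Real.log N) ^ ((1 : ℝ) / 10)}


/-- A finite set `T ⊆ Σ_N` is a `(1-δ)`-boosting set at parameter `p` if
`ℙ_p((⋂_{x : ω_x = 1} H(x)) ∩ (⋂_{x ∈ T} H(x)) = ∅) ≥ 1 - δ`. -/
def PerceptronBoosting {N : ℕ} (κ p δ : ℝ) (T : Finset (Cube N)) : Prop :=
  bernoulliP p
      {ω : Cube N → Bool |
        ((⋂ x ∈ {x : Cube N | ω x = true}, halfCube κ x) ∩ ⋂ x ∈ T, halfCube κ x) =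
          (∅ : Set (Cube N))} ≥ 1 - δ

/-- The sign-switching action of `g ∈ Σ_N` on `x ∈ Σ_N`: `(g∘x)^i = g^i x^i`.
In the boolean encoding the product of signs `g^i x^i` is `+1` iff `g^i = x^i`. -/
def signSwitch {N : ℕ} (g : Cube N) (x : Cube N) : Cube N := fun i => g i == x i

/-- For a tuple `Y = (y_1, …, y_{k+1}) ∈ Σ_N^{k+1}` and a sign pattern
`a ∈ {-1,1}^k`, the set `I_a(Y)` of positions `j ∈ [N]` where the `j`-th
component of `y_1 ∘ y_{i+1}` equals `a_i` for every `i`. -/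
def Ia {N k : ℕ} (Y : Fin (k + 1) → Cube N) (a : Fin k → Bool) : Set (Fin N) :=
  {j | ∀ i : Fin k, signSwitch (Y 0) (Y i.succ) j = a i}

/-- A tuple `Y ∈ Σ_N^{k+1}` is admissible (with constant `C₂`) if
`||I_a(Y)| - 2^{-k} N| ≤ C₂ (N log N)^{1/2}` for every `a ∈ {-1,1}^k`. -/
def Admissible {N k : ℕ} (C₂ : ℝ) (Y : Fin (k + 1) → Cube N) : Prop :=
  ∀ a : Fin k → Bool,
    |((Ia Y a).ncard : ℝ) - (2 : ℝ) ^ (-(k : ℝ)) * N| ≤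
      C₂ * Real.sqrt (N * Real.log N)

set_option linter.unusedSectionVars false
set_option linter.unusedVariables false

def bw (p : ℝ) (b : Bool) : ℝ := if b then p else 1 - p

def Ex {V : Type*} [Fintype V] [DecidableEq V] (p : ℝ) (F : (V → Bool) → ℝ) : ℝ :=
  ∑ ω, (∏ i, bw p (ω i)) * F ω

section gen
variable {V : Type*} [Fintype V] [DecidableEq V] {p : ℝ}

lemma Ex_prod (g : V → Bool → ℝ) :
    Ex p (fun ω : V → Bool => ∏ i, g i (ω i)) = ∏ i, (p * g i true + (1 - p) * g i false) := by
  have h : ∀ i, p * g i true + (1 - p) * g i false = ∑ b : Bool, bw p b * g i b := by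
    intro i; simp [bw]
  simp only [h, Finset.prod_univ_sum, Fintype.piFinset_univ, Ex, ← Finset.prod_mul_distrib]

lemma Ex_one : Ex p (fun _ : V → Bool => (1 : ℝ)) = 1 := by
  have := Ex_prod (V := V) (p := p) (fun _ _ => 1)
  simpa using this

lemma Ex_add (F G : (V → Bool) → ℝ) : Ex p (fun ω => F ω + G ω) = Ex p F + Ex p G := by
  simp [Ex, mul_add, Finset.sum_add_distrib]

lemma Ex_sub (F G : (V → Bool) → ℝ) : Ex p (fun ω => F ω - G ω) = Ex p F - Ex p G := by
  simp [Ex, mul_sub, Finset.sum_sub_distrib]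

lemma Ex_const_mul (c : ℝ) (F : (V → Bool) → ℝ) : Ex p (fun ω => c * F ω) = c * Ex p F := by
  simp only [Ex, Finset.mul_sum]; refine Finset.sum_congr rfl fun ω _ => by ring

lemma Ex_const (c : ℝ) : Ex p (fun _ : V → Bool => c) = c := by
  have := Ex_const_mul (V := V) (p := p) c (fun _ => 1)
  simpa [Ex_one] using this

lemma Ex_sum {ι : Type*} (s : Finset ι) (F : ι → (V → Bool) → ℝ) :
    Ex p (fun ω => ∑ i ∈ s, F i ω) = ∑ i ∈ s, Ex p (F i) := by
  simp only [Ex, Finset.mul_sum]; rw [Finset.sum_comm]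

lemma bw_nonneg (h0 : 0 ≤ p) (h1 : p ≤ 1) (b : Bool) : 0 ≤ bw p b := by
  unfold bw; split_ifs <;> linarith

lemma w_nonneg (h0 : 0 ≤ p) (h1 : p ≤ 1) (ω : V → Bool) : 0 ≤ ∏ i, bw p (ω i) :=
  Finset.prod_nonneg fun i _ => bw_nonneg h0 h1 _

lemma Ex_mono (h0 : 0 ≤ p) (h1 : p ≤ 1) {F G : (V → Bool) → ℝ} (h : ∀ ω, F ω ≤ G ω) :
    Ex p F ≤ Ex p G :=
  Finset.sum_le_sum fun ω _ => mul_le_mul_of_nonneg_left (h ω) (w_nonneg h0 h1 ω)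

lemma Ex_nonneg (h0 : 0 ≤ p) (h1 : p ≤ 1) {F : (V → Bool) → ℝ} (h : ∀ ω, 0 ≤ F ω) :
    0 ≤ Ex p F :=
  Finset.sum_nonneg fun ω _ => mul_nonneg (w_nonneg h0 h1 ω) (h ω)

lemma w_update (ω : V → Bool) (i : V) (b : Bool) :
    (∏ j, bw p (Function.update ω i b j)) * bw p (ω i) = (∏ j, bw p (ω j)) * bw p b := by
  rw [← Finset.mul_prod_erase _ _ (Finset.mem_univ i), ← Finset.mul_prod_erase _ (fun j => bw p (ω j)) (Finset.mem_univ i)]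
  have : ∏ x ∈ Finset.univ.erase i, bw p (Function.update ω i b x) = ∏ x ∈ Finset.univ.erase i, bw p (ω x) := by
    refine Finset.prod_congr rfl fun j hj => ?_
    rw [Function.update_of_ne (Finset.ne_of_mem_erase hj)]
  rw [this]; simp; ring

lemma Ex_resample' (i : V) (F : (V → Bool) → Bool → ℝ) :
    ∑ ω : V → Bool, ∑ b : Bool, (∏ j, bw p (ω j)) * bw p b * F ω b =
    ∑ ω : V → Bool, ∑ b : Bool, (∏ j, bw p (ω j)) * bw p b * F (Function.update ω i b) (ω i) := by
  rw [← Fintype.sum_prod_type', ← Fintype.sum_prod_type']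
  refine Fintype.sum_bijective (fun x : (V → Bool) × Bool => (Function.update x.1 i x.2, x.1 i)) ?_ _ _ ?_
  · refine Function.Involutive.bijective ?_
    rintro ⟨ω, b⟩; simp
  · rintro ⟨ω, b⟩
    simp [w_update]

lemma Ex_resample (i : V) (F : (V → Bool) → ℝ) :
    Ex p F = Ex p (fun ω => p * F (Function.update ω i true) + (1 - p) * F (Function.update ω i false)) := by
  have := Ex_resample' (p := p) i (fun ω _ => F ω)
  unfold Ex
  simp only [Fintype.sum_bool] at this
  simp only [bw, if_true, Bool.false_eq_true, if_false] at this ⊢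
  convert this using 2 <;> ring

def ph (p : ℝ) (b : Bool) : ℝ := if b then 1 else -(p / (1 - p))

def phi (p : ℝ) (S : Finset V) (ω : V → Bool) : ℝ := ∏ i ∈ S, ph p (ω i)

lemma phi_eq (S : Finset V) (ω : V → Bool) :
    phi p S ω = ∏ i, (if i ∈ S then ph p (ω i) else 1) := by
  simp [phi, Finset.prod_ite_mem]

lemma phi_orth (hp : p < 1) (S T : Finset V) :
    Ex p (fun ω => phi p S ω * phi p T ω) = if S = T then (p / (1 - p)) ^ S.card else 0 := by
  have hq : 1 - p ≠ 0 := by linarith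
  have h1 := Ex_prod (p := p) (fun i b => (if i ∈ S then ph p b else 1) * (if i ∈ T then ph p b else 1))
  simp only [phi_eq, ← Finset.prod_mul_distrib]
  rw [h1]
  split_ifs with h
  · subst h
    rw [← Finset.prod_const, ← Finset.prod_subset (Finset.subset_univ S)]
    · refine Finset.prod_congr rfl fun i hi => ?_
      simp [hi, ph]; field_simp; ring
    · intro i _ hi; simp [hi]
  · have : ∃ i, ¬ (i ∈ S ↔ i ∈ T) := by
      by_contra hc; push Not at hc; exact h (Finset.ext hc)
    obtain ⟨i, hi⟩ := this
    refine Finset.prod_eq_zero (Finset.mem_univ i) ?_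
    by_cases hS : i ∈ S <;> by_cases hT : i ∈ T <;> simp [hS, hT, ph] at hi ⊢ <;> field_simp <;> ring

def pol (p : ℝ) (a : Finset V → ℝ) (ω : V → Bool) : ℝ := ∑ S, a S * phi p S ω

lemma parseval2 (hp : p < 1) (a b : Finset V → ℝ) :
    Ex p (fun ω => pol p a ω * pol p b ω) = ∑ S, a S * b S * (p / (1 - p)) ^ S.card := by
  have : (fun ω => pol p a ω * pol p b ω) = fun ω => ∑ S, ∑ T, (a S * b T) * (phi p S ω * phi p T ω) := by
    funext ω
    simp only [pol, Finset.sum_mul_sum]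
    refine Finset.sum_congr rfl fun S _ => Finset.sum_congr rfl fun T _ => by ring
  rw [this, Ex_sum]
  refine Finset.sum_congr rfl fun S _ => ?_
  rw [Ex_sum]
  simp only [Ex_const_mul, phi_orth hp]
  simp

lemma parseval (hp : p < 1) (a : Finset V → ℝ) :
    Ex p (fun ω => pol p a ω ^ 2) = ∑ S, a S ^ 2 * (p / (1 - p)) ^ S.card := by
  simpa [sq] using parseval2 hp a a

lemma exists_pol (hp : p < 1) (F : (V → Bool) → ℝ) : ∃ a : Finset V → ℝ, ∀ ω, F ω = pol p a ω := by
  have hq : 1 - p ≠ 0 := by linarith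
  have key : ∀ η : V → Bool, ∃ a : Finset V → ℝ, ∀ ω, (if ω = η then (1:ℝ) else 0) = pol p a ω := by
    intro η
    refine ⟨fun S => (∏ i ∈ S, (if η i then (1 - p) else -(1 - p))) * ∏ i ∈ Finset.univ \ S, bw p (η i), fun ω => ?_⟩
    have h1 : (if ω = η then (1:ℝ) else 0) = ∏ i, ((if η i then (1 - p) else -(1 - p)) * ph p (ω i) + bw p (η i)) := by
      have : ∀ i, ((if η i then (1 - p) else -(1 - p)) * ph p (ω i) + bw p (η i)) = if ω i = η i then 1 else 0 := by
        intro i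
        cases h1 : η i <;> cases h2 : ω i <;> simp [ph, bw] <;> field_simp <;> ring
      simp only [this]
      rw [Finset.prod_ite_zero]; simp [funext_iff]
    rw [h1, Finset.prod_add]
    simp only [Finset.powerset_univ, pol, phi]
    refine Finset.sum_congr rfl fun S _ => ?_
    rw [Finset.prod_mul_distrib]; ring
  choose a ha using key
  refine ⟨fun S => ∑ η, F η * a η S, fun ω => ?_⟩
  have : F ω = ∑ η, F η * (if ω = η then (1:ℝ) else 0) := by simp
  rw [this]
  simp only [ha, pol, Finset.mul_sum, Finset.sum_mul]
  rw [Finset.sum_comm]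
  refine Finset.sum_congr rfl fun S _ => Finset.sum_congr rfl fun η _ => by ring

lemma phi_update_mem {i : V} {S : Finset V} (h : i ∈ S) (ω : V → Bool) (b : Bool) :
    phi p S (Function.update ω i b) = ph p b * phi p (S.erase i) ω := by
  unfold phi
  rw [← Finset.mul_prod_erase _ _ h]
  congr 1
  · simp
  · refine Finset.prod_congr rfl fun j hj => ?_
    rw [Function.update_of_ne (Finset.ne_of_mem_erase hj)]

lemma phi_update_notMem {i : V} {S : Finset V} (h : i ∉ S) (ω : V → Bool) (b : Bool) :
    phi p S (Function.update ω i b) = phi p S ω := by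
  unfold phi
  refine Finset.prod_congr rfl fun j hj => ?_
  rw [Function.update_of_ne]; rintro rfl; exact h hj

def dco (i : V) (a : Finset V → ℝ) : Finset V → ℝ := fun S => if i ∈ S then 0 else a (insert i S)

lemma sum_mem_reindex (i : V) (g : Finset V → ℝ) :
    ∑ S : Finset V, (if i ∈ S then g (S.erase i) else 0) = ∑ S : Finset V, (if i ∈ S then 0 else g S) := by
  rw [← Finset.sum_filter]
  have : ∀ S : Finset V, (if i ∈ S then 0 else g S) = if i ∉ S then g S else 0 := by
    intro S; split_ifs <;> simp_all
  simp only [this]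
  rw [← Finset.sum_filter]
  refine Finset.sum_bij' (fun S _ => S.erase i) (fun S _ => insert i S) ?_ ?_ ?_ ?_ ?_ <;> simp +contextual

lemma pol_deriv (hp : p < 1) (i : V) (a : Finset V → ℝ) (ω : V → Bool) :
    (1 - p) * (pol p a (Function.update ω i true) - pol p a (Function.update ω i false)) = pol p (dco i a) ω := by
  have hq : 1 - p ≠ 0 := by linarith
  have h1 : pol p (dco i a) ω = ∑ S, (if i ∈ S then 0 else a (insert i S) * phi p S ω) := by
    unfold pol dco
    refine Finset.sum_congr rfl fun S _ => by split_ifs <;> simp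
  rw [h1, ← sum_mem_reindex i (fun S => a (insert i S) * phi p S ω)]
  unfold pol
  rw [← Finset.sum_sub_distrib, Finset.mul_sum]
  refine Finset.sum_congr rfl fun S _ => ?_
  split_ifs with h
  · rw [phi_update_mem h, phi_update_mem h, Finset.insert_erase h]
    simp [ph]; field_simp; ring
  · rw [phi_update_notMem h, phi_update_notMem h]; ring
end gen

section gen
variable {V : Type*} [Fintype V] [DecidableEq V] {p : ℝ}

def polU (p : ℝ) (U : Finset V) (a : Finset V → ℝ) (ω : V → Bool) : ℝ :=
  ∑ S ∈ U.powerset, a S * phi p S ω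

def NN (r : ℝ) (U : Finset V) (a : Finset V → ℝ) (T : Finset V) : ℝ :=
  ∑ S ∈ (U \ T).powerset, (4 * r) ^ S.card * a (S ∪ T) ^ 2

lemma polU_insert {i : V} {U : Finset V} (hi : i ∉ U) (a : Finset V → ℝ) (ω : V → Bool) (b : Bool) :
    polU p (insert i U) a (Function.update ω i b) =
      polU p U a ω + ph p b * polU p U (fun S => a (insert i S)) ω := by
  unfold polU
  rw [Finset.sum_powerset_insert hi, Finset.mul_sum]
  congr 1
  · refine Finset.sum_congr rfl fun S hS => ?_
    rw [phi_update_notMem]; exact fun h => hi (Finset.mem_powerset.1 hS h)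
  · refine Finset.sum_congr rfl fun S hS => ?_
    have : i ∉ S := fun h => hi (Finset.mem_powerset.1 hS h)
    rw [phi_update_mem (Finset.mem_insert_self i S), Finset.erase_insert this]; ring

lemma NN_insert_notMem (r : ℝ) {i : V} {U T : Finset V} (hi : i ∉ U) (hT : T ⊆ U) (a : Finset V → ℝ) :
    NN r (insert i U) a T = NN r U a T + 4 * r * NN r U (fun S => a (insert i S)) T := by
  have hiT : i ∉ T := fun h => hi (hT h)
  unfold NN
  rw [Finset.insert_sdiff_of_notMem _ hiT, Finset.sum_powerset_insert (by simp [hi]), Finset.mul_sum]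
  congr 1
  refine Finset.sum_congr rfl fun S hS => ?_
  have : i ∉ S := fun h => hi (Finset.mem_sdiff.1 (Finset.mem_powerset.1 hS h)).1
  rw [Finset.card_insert_of_notMem this, Finset.insert_union]; ring

lemma NN_insert_mem (r : ℝ) {i : V} {U T : Finset V} (hi : i ∉ U) (hT : T ⊆ U) (a : Finset V → ℝ) :
    NN r (insert i U) a (insert i T) = NN r U (fun S => a (insert i S)) T := by
  unfold NN
  have : insert i U \ insert i T = U \ T := by
    ext x; simp only [Finset.mem_sdiff, Finset.mem_insert]
    constructor
    · tauto
    · rintro ⟨h1, h2⟩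
      refine ⟨Or.inr h1, ?_⟩
      rintro (rfl | h); exacts [hi h1, h2 h]
  rw [this]
  refine Finset.sum_congr rfl fun S hS => ?_
  rw [Finset.union_insert]

lemma NN_nonneg {r : ℝ} (hr : 0 ≤ r) (U : Finset V) (a : Finset V → ℝ) (T : Finset V) : 0 ≤ NN r U a T :=
  Finset.sum_nonneg fun S _ => by positivity

lemma oneD (h0 : 0 ≤ p) (h1 : p ≤ 1/2) (A B C D : ℝ) :
    p * ((A + ph p true * B) ^ 2 * (C + ph p true * D) ^ 2) +
      (1 - p) * ((A + ph p false * B) ^ 2 * (C + ph p false * D) ^ 2) ≤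
    A ^ 2 * C ^ 2 + 4 * (p / (1 - p)) * (A ^ 2 * D ^ 2) + 4 * (p / (1 - p)) * (B ^ 2 * C ^ 2)
      + 3 * (p / (1 - p)) * (B ^ 2 * D ^ 2) := by
  have hq : 0 < 1 - p := by linarith
  set r := p / (1 - p) with hr
  have hpr : p = r * (1 - p) := by rw [hr]; field_simp
  have hr0 : 0 ≤ r := by positivity
  have hr1 : r ≤ 1 := by rw [hr, div_le_one hq]; linarith
  have hqr : 1 - p = 1 / (1 + r) := by
    rw [hr]; field_simp; ring
  have hp' : p = r / (1 + r) := by rw [hr]; field_simp; ring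
  simp only [ph, if_true, Bool.false_eq_true, if_false, ← hr]
  have e : p * ((A + 1 * B) ^ 2 * (C + 1 * D) ^ 2) + (1 - p) * ((A + -r * B) ^ 2 * (C + -r * D) ^ 2)
      = A ^ 2 * C ^ 2 + r * (A ^ 2 * D ^ 2 + B ^ 2 * C ^ 2 + 4 * (A * D) * (B * C))
        + (2 * A * B * D ^ 2 + 2 * C * D * B ^ 2) * (r * (1 - r)) + B ^ 2 * D ^ 2 * (r * (1 - r + r ^ 2)) := by
    rw [hqr, hp']; field_simp; ring
  rw [e]
  have k1 : 4 * (A * D) * (B * C) ≤ 2 * (A ^ 2 * D ^ 2) + 2 * (B ^ 2 * C ^ 2) := by nlinarith [sq_nonneg (A * D - B * C)]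
  have k2 : 2 * A * B * D ^ 2 + 2 * C * D * B ^ 2 ≤ A ^ 2 * D ^ 2 + B ^ 2 * C ^ 2 + 2 * (B ^ 2 * D ^ 2) := by
    nlinarith [sq_nonneg (A * D - B * D), sq_nonneg (B * C - B * D)]
  have k0 : 0 ≤ A ^ 2 * D ^ 2 + B ^ 2 * C ^ 2 + 2 * (B ^ 2 * D ^ 2) := by positivity
  have k3 : (2 * A * B * D ^ 2 + 2 * C * D * B ^ 2) * (r * (1 - r)) ≤
      (A ^ 2 * D ^ 2 + B ^ 2 * C ^ 2 + 2 * (B ^ 2 * D ^ 2)) * r := by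
    have : 0 ≤ r * (1 - r) := mul_nonneg hr0 (by linarith)
    have h2 : r * (1 - r) ≤ r := by nlinarith
    calc _ ≤ (A ^ 2 * D ^ 2 + B ^ 2 * C ^ 2 + 2 * (B ^ 2 * D ^ 2)) * (r * (1 - r)) :=
          mul_le_mul_of_nonneg_right k2 this
      _ ≤ _ := mul_le_mul_of_nonneg_left h2 k0
  have k4 : B ^ 2 * D ^ 2 * (r * (1 - r + r ^ 2)) ≤ B ^ 2 * D ^ 2 * r := by
    have : r * (1 - r + r ^ 2) ≤ r := by
      have : 1 - r + r ^ 2 ≤ 1 := by nlinarith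
      nlinarith
    exact mul_le_mul_of_nonneg_left this (by positivity)
  have k5 := mul_le_mul_of_nonneg_left k1 hr0
  nlinarith

lemma fourth_mixed (h0 : 0 ≤ p) (h1 : p ≤ 1/2) (U : Finset V) : ∀ a d : Finset V → ℝ,
    Ex p (fun ω => polU p U a ω ^ 2 * polU p U d ω ^ 2) ≤
      ∑ T ∈ U.powerset, (3 * (p / (1 - p))) ^ T.card * (NN (p / (1 - p)) U a T * NN (p / (1 - p)) U d T) := by
  have hr : 0 ≤ p / (1 - p) := div_nonneg h0 (by linarith)
  induction U using Finset.induction_on with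
  | empty =>
    intro a d
    simp [polU, NN, phi, Ex_const]
  | insert i U hi ih =>
    intro a d
    set r := p / (1 - p) with hrd
    set a' : Finset V → ℝ := fun S => a (insert i S)
    set d' : Finset V → ℝ := fun S => d (insert i S)
    rw [Ex_resample i]
    have s1 : Ex p (fun ω => p * (polU p (insert i U) a (Function.update ω i true) ^ 2 * polU p (insert i U) d (Function.update ω i true) ^ 2) +
        (1 - p) * (polU p (insert i U) a (Function.update ω i false) ^ 2 * polU p (insert i U) d (Function.update ω i false) ^ 2)) ≤
        Ex p (fun ω => polU p U a ω ^ 2 * polU p U d ω ^ 2 + 4 * r * (polU p U a ω ^ 2 * polU p U d' ω ^ 2)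
         + 4 * r * (polU p U a' ω ^ 2 * polU p U d ω ^ 2) + 3 * r * (polU p U a' ω ^ 2 * polU p U d' ω ^ 2)) := by
      refine Ex_mono h0 (by linarith) fun ω => ?_
      simp only [polU_insert hi]
      exact oneD h0 h1 _ _ _ _
    refine s1.trans ?_
    rw [Ex_add, Ex_add, Ex_add, Ex_const_mul, Ex_const_mul, Ex_const_mul]
    rw [Finset.sum_powerset_insert hi]
    have e1 : ∑ T ∈ U.powerset, (3 * r) ^ T.card * (NN r (insert i U) a T * NN r (insert i U) d T) =
        ∑ T ∈ U.powerset, (3 * r) ^ T.card * ((NN r U a T + 4 * r * NN r U a' T) * (NN r U d T + 4 * r * NN r U d' T)) := by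
      refine Finset.sum_congr rfl fun T hT => ?_
      rw [NN_insert_notMem r hi (Finset.mem_powerset.1 hT), NN_insert_notMem r hi (Finset.mem_powerset.1 hT)]
    have e2 : ∑ T ∈ U.powerset, (3 * r) ^ (insert i T).card * (NN r (insert i U) a (insert i T) * NN r (insert i U) d (insert i T)) =
        ∑ T ∈ U.powerset, (3 * r) ^ T.card * (3 * r * (NN r U a' T * NN r U d' T)) := by
      refine Finset.sum_congr rfl fun T hT => ?_
      have hT' := Finset.mem_powerset.1 hT
      rw [NN_insert_mem r hi hT', NN_insert_mem r hi hT', Finset.card_insert_of_notMem (fun h => hi (hT' h))]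
      ring
    rw [e1, e2, ← Finset.sum_add_distrib]
    have i1 := ih a d
    have i2 := mul_le_mul_of_nonneg_left (ih a d') (show 0 ≤ 4 * r by positivity)
    have i3 := mul_le_mul_of_nonneg_left (ih a' d) (show 0 ≤ 4 * r by positivity)
    have i4 := mul_le_mul_of_nonneg_left (ih a' d') (show 0 ≤ 3 * r by positivity)
    refine (add_le_add (add_le_add (add_le_add i1 i2) i3) i4).trans ?_
    rw [Finset.mul_sum, Finset.mul_sum, Finset.mul_sum, ← Finset.sum_add_distrib, ← Finset.sum_add_distrib, ← Finset.sum_add_distrib]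
    refine Finset.sum_le_sum fun T hT => ?_
    have n1 := NN_nonneg hr U a' T
    have n2 := NN_nonneg hr U d' T
    have : 0 ≤ (3 * r) ^ T.card * (4 * r * (4 * r) * (NN r U a' T * NN r U d' T)) := by positivity
    nlinarith

def Nf (r : ℝ) (a : Finset V → ℝ) (T : Finset V) : ℝ :=
  ∑ S : Finset V, if T ⊆ S then r ^ (S \ T).card * a S ^ 2 else 0

lemma Nf_nonneg {r : ℝ} (hr : 0 ≤ r) (a : Finset V → ℝ) (T : Finset V) : 0 ≤ Nf r a T :=
  Finset.sum_nonneg fun S _ => by split_ifs <;> positivity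

lemma sum_superset_reindex (T : Finset V) (g : Finset V → ℝ) :
    ∑ S ∈ (Finset.univ \ T).powerset, g (S ∪ T) = ∑ S : Finset V, if T ⊆ S then g S else 0 := by
  rw [← Finset.sum_filter]
  refine Finset.sum_bij' (fun S _ => S ∪ T) (fun S _ => S \ T) ?_ ?_ ?_ ?_ ?_
  · intro S _; simp
  · intro S _; simp only [Finset.mem_powerset]; exact Finset.sdiff_subset_sdiff (Finset.subset_univ _) le_rfl
  · intro S hS
    have : Disjoint S T := (Finset.disjoint_of_subset_left (Finset.mem_powerset.1 hS) Finset.sdiff_disjoint)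
    rw [Finset.union_sdiff_right]; exact Finset.sdiff_eq_self_of_disjoint this
  · intro S hS; simp at hS; exact Finset.sdiff_union_of_subset hS
  · intro S _; rfl

lemma NN_le (r : ℝ) (hr : 0 ≤ r) (k : ℕ) (a : Finset V → ℝ) (ha : ∀ S, k < S.card → a S = 0) (T : Finset V) :
    NN r Finset.univ a T ≤ 4 ^ k * Nf r a T := by
  have e : NN r Finset.univ a T = ∑ S ∈ (Finset.univ \ T).powerset, (fun S => (4 * r) ^ (S \ T).card * a S ^ 2) (S ∪ T) := by
    unfold NN
    refine Finset.sum_congr rfl fun S hS => ?_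
    have : Disjoint S T := (Finset.disjoint_of_subset_left (Finset.mem_powerset.1 hS) Finset.sdiff_disjoint)
    simp only [Finset.union_sdiff_right]
    rw [Finset.sdiff_eq_self_of_disjoint this]
  rw [e, sum_superset_reindex T (fun S => (4 * r) ^ (S \ T).card * a S ^ 2), Nf, Finset.mul_sum]
  refine Finset.sum_le_sum fun S _ => ?_
  split_ifs with h
  · by_cases hk : k < S.card
    · simp [ha S hk]
    · rw [mul_pow, mul_assoc]
      refine mul_le_mul_of_nonneg_right ?_ (by positivity)
      exact pow_le_pow_right₀ (by norm_num) ((Finset.card_le_card Finset.sdiff_subset).trans (not_lt.1 hk))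
  · simp

lemma sum_T_Nf (r : ℝ) (hr : 0 ≤ r) (z : ℝ) (hz : 0 ≤ z) (k : ℕ) (a : Finset V → ℝ) (ha : ∀ S, k < S.card → a S = 0) (Z : Finset V) :
    ∑ T : Finset V, (if Z ⊆ T then (z * r) ^ (T \ Z).card * Nf r a T else 0) ≤ (1 + z) ^ k * Nf r a Z := by
  simp only [Nf, Finset.mul_sum]
  have : ∀ T : Finset V, (if Z ⊆ T then ∑ S : Finset V, (z * r) ^ (T \ Z).card * (if T ⊆ S then r ^ (S \ T).card * a S ^ 2 else 0) else 0)
     = ∑ S : Finset V, (if Z ⊆ T ∧ T ⊆ S then z ^ (T \ Z).card * (r ^ (S \ Z).card * a S ^ 2) else 0) := by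
    intro T
    by_cases h : Z ⊆ T
    · simp only [h, if_true, true_and]
      refine Finset.sum_congr rfl fun S _ => ?_
      split_ifs with h2
      · have : (S \ Z).card = (T \ Z).card + (S \ T).card := by
          rw [Finset.card_sdiff_of_subset (h.trans h2), Finset.card_sdiff_of_subset h, Finset.card_sdiff_of_subset h2]
          have := Finset.card_le_card h; have := Finset.card_le_card h2; omega
        rw [this, mul_pow, pow_add]; ring
      · simp
    · simp [h]
  simp only [this]
  rw [Finset.sum_comm]
  refine Finset.sum_le_sum fun S _ => ?_
  by_cases hZ : Z ⊆ S
  · simp only [hZ, if_true]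
    by_cases hk : k < S.card
    · simp [ha S hk]
    · have e : ∑ T : Finset V, (if Z ⊆ T ∧ T ⊆ S then z ^ (T \ Z).card * (r ^ (S \ Z).card * a S ^ 2) else 0)
        = (1 + z) ^ (S \ Z).card * (r ^ (S \ Z).card * a S ^ 2) := by
        have e2 : (1 + z) ^ (S \ Z).card = ∑ T : Finset V, if Z ⊆ T ∧ T ⊆ S then z ^ (T \ Z).card else 0 := by
          rw [add_comm, ← Finset.prod_const, Finset.prod_add, ← Finset.sum_filter]
          refine Finset.sum_bij' (fun X _ => X ∪ Z) (fun T _ => T \ Z) ?_ ?_ ?_ ?_ ?_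
          · intro X hX; simp only [Finset.mem_powerset] at hX
            simp only [Finset.mem_filter, Finset.mem_univ, true_and]
            exact ⟨Finset.subset_union_right, Finset.union_subset (hX.trans Finset.sdiff_subset) hZ⟩
          · intro T hT; simp only [Finset.mem_filter, Finset.mem_univ, true_and] at hT
            simp only [Finset.mem_powerset]; exact Finset.sdiff_subset_sdiff hT.2 le_rfl
          · intro X hX; simp only [Finset.mem_powerset] at hX
            have : Disjoint X Z := (Finset.disjoint_of_subset_left hX Finset.sdiff_disjoint)
            simp only [Finset.union_sdiff_right]; exact Finset.sdiff_eq_self_of_disjoint this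
          · intro T hT; simp only [Finset.mem_filter, Finset.mem_univ, true_and] at hT
            exact Finset.sdiff_union_of_subset hT.1
          · intro X hX; simp only [Finset.mem_powerset] at hX
            have : Disjoint X Z := (Finset.disjoint_of_subset_left hX Finset.sdiff_disjoint)
            simp only [Finset.union_sdiff_right, Finset.sdiff_eq_self_of_disjoint this]; simp
        rw [e2, Finset.sum_mul]
        refine Finset.sum_congr rfl fun T _ => by split_ifs <;> simp
      rw [e]
      refine mul_le_mul_of_nonneg_right ?_ (by positivity)
      exact pow_le_pow_right₀ (by linarith) ((Finset.card_le_card Finset.sdiff_subset).trans (not_lt.1 hk))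
  · have : ∀ T : Finset V, ¬ (Z ⊆ T ∧ T ⊆ S) := fun T h => hZ (h.1.trans h.2)
    simp [this, hZ]

lemma Nf_empty (r : ℝ) (a : Finset V → ℝ) : Nf r a ∅ = ∑ S, a S ^ 2 * r ^ S.card := by
  simp [Nf, mul_comm]

lemma fourth_le (h0 : 0 ≤ p) (h1 : p ≤ 1/2) (k : ℕ) (a : Finset V → ℝ) (ha : ∀ S, k < S.card → a S = 0)
    (c2 : ℝ) (hc : ∀ T, Nf (p / (1 - p)) a T ≤ c2) :
    Ex p (fun ω => pol p a ω ^ 4) ≤ 64 ^ k * c2 * Ex p (fun ω => pol p a ω ^ 2) := by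
  have hr : 0 ≤ p / (1 - p) := div_nonneg h0 (by linarith)
  have key := fourth_mixed h0 h1 (Finset.univ : Finset V) a a
  have e : ∀ ω, polU p (Finset.univ : Finset V) a ω = pol p a ω := by intro ω; simp [polU, pol]
  simp only [e, Finset.powerset_univ] at key
  rw [parseval (by linarith), ← Nf_empty]
  set r := p / (1 - p)
  calc Ex p (fun ω => pol p a ω ^ 4) = Ex p (fun ω => pol p a ω ^ 2 * pol p a ω ^ 2) := by
        congr 1; funext ω; ring
    _ ≤ _ := key
    _ ≤ ∑ T : Finset V, (16 ^ k * c2) * ((3 * r) ^ T.card * Nf r a T) := by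
        refine Finset.sum_le_sum fun T _ => ?_
        have b1 := NN_le r hr k a ha T
        have b0 := NN_nonneg hr Finset.univ a T
        have b2 := Nf_nonneg hr a T
        have : NN r Finset.univ a T * NN r Finset.univ a T ≤ (16 ^ k * c2) * Nf r a T := by
          calc _ ≤ (4 ^ k * Nf r a T) * (4 ^ k * Nf r a T) := mul_le_mul b1 b1 b0 (by positivity)
            _ = 16 ^ k * (Nf r a T * Nf r a T) := by
              rw [show (16:ℝ) = 4 * 4 by norm_num, mul_pow]; ring
            _ ≤ 16 ^ k * (c2 * Nf r a T) := by
              refine mul_le_mul_of_nonneg_left (mul_le_mul_of_nonneg_right (hc T) b2) (by positivity)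
            _ = _ := by ring
        calc _ ≤ (3 * r) ^ T.card * ((16 ^ k * c2) * Nf r a T) := mul_le_mul_of_nonneg_left this (by positivity)
          _ = _ := by ring
    _ = (16 ^ k * c2) * ∑ T : Finset V, (if ∅ ⊆ T then (3 * r) ^ (T \ ∅).card * Nf r a T else 0) := by
        rw [Finset.mul_sum]; simp
    _ ≤ (16 ^ k * c2) * ((1 + 3) ^ k * Nf r a ∅) := by
        have : 0 ≤ c2 := (Nf_nonneg hr a ∅).trans (hc ∅)
        exact mul_le_mul_of_nonneg_left (sum_T_Nf r hr 3 (by norm_num) k a ha ∅) (by positivity)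
    _ = _ := by
        rw [show (64:ℝ) = 16 * 4 by norm_num, mul_pow]; norm_num; ring
end gen

section gen
variable {V : Type*} [Fintype V] [DecidableEq V] {p : ℝ}

def BB (r : ℝ) (a : Finset V → ℝ) (c : ℝ) : Finset (Finset V) :=
  Finset.univ.filter fun T => T ≠ ∅ ∧ c ≤ Nf r a T

def core (B : Finset (Finset V)) (S : Finset V) : Finset V := (B.filter (· ⊆ S)).biUnion id

lemma core_subset (B : Finset (Finset V)) (S : Finset V) : core B S ⊆ S := by
  intro x hx
  simp only [core, Finset.mem_biUnion, Finset.mem_filter, id] at hx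
  obtain ⟨T, hT, h⟩ := hx
  exact hT.2 h

lemma subset_core {B : Finset (Finset V)} {S T : Finset V} (hT : T ∈ B) (h : T ⊆ S) : T ⊆ core B S := by
  intro x hx
  simp only [core, Finset.mem_biUnion, Finset.mem_filter, id]
  exact ⟨T, ⟨hT, h⟩, hx⟩

lemma mem_core {B : Finset (Finset V)} {S : Finset V} {x : V} : x ∈ core B S ↔ ∃ T ∈ B, T ⊆ S ∧ x ∈ T := by
  simp [core, and_assoc]

lemma core_mono (B : Finset (Finset V)) {S S' : Finset V} (h : S ⊆ S') : core B S ⊆ core B S' := by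
  intro x hx
  rw [mem_core] at hx ⊢
  obtain ⟨T, h1, h2, h3⟩ := hx
  exact ⟨T, h1, h2.trans h, h3⟩

lemma core_core (B : Finset (Finset V)) (S : Finset V) : core B (core B S) = core B S := by
  refine (core_subset _ _).antisymm ?_
  intro x hx
  rw [mem_core] at hx ⊢
  obtain ⟨T, h1, h2, h3⟩ := hx
  exact ⟨T, h1, subset_core h1 h2, h3⟩

def trunc (k : ℕ) (a : Finset V → ℝ) : Finset V → ℝ := fun S => if S.card ≤ k then a S else 0

lemma trunc_zero (k : ℕ) (a : Finset V → ℝ) (S : Finset V) (h : k < S.card) : trunc k a S = 0 := by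
  simp [trunc, h]

def hco (B : Finset (Finset V)) (i : V) (a : Finset V → ℝ) : Finset V → ℝ :=
  fun S => if i ∈ S then 0 else if i ∈ core B (insert i S) then 0 else a (insert i S)

lemma Nf_hco (r : ℝ) (hr : 0 ≤ r) (a : Finset V → ℝ) (c : ℝ) (hc : 0 < c) (i : V) (T : Finset V) :
    Nf r (hco (BB r a c) i a) T ≤ c := by
  by_cases hiT : i ∈ T
  · have : Nf r (hco (BB r a c) i a) T = 0 := by
      unfold Nf
      refine Finset.sum_eq_zero fun S _ => ?_
      split_ifs with h
      · simp [hco, h hiT]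
      · rfl
    rw [this]; exact hc.le
  by_cases hB : insert i T ∈ BB r a c
  · have : Nf r (hco (BB r a c) i a) T = 0 := by
      unfold Nf
      refine Finset.sum_eq_zero fun S _ => ?_
      split_ifs with h
      · have : i ∈ core (BB r a c) (insert i S) :=
          subset_core hB (Finset.insert_subset_insert i h) (Finset.mem_insert_self _ _)
        simp [hco, this]
      · rfl
    rw [this]; exact hc.le
  · have h1 : Nf r a (insert i T) < c := by
      simpa [BB] using hB
    refine le_trans ?_ h1.le
    have h2 : Nf r (hco (BB r a c) i a) T ≤ ∑ S : Finset V, (if i ∈ S then 0 else (if T ⊆ S then r ^ (S \ T).card * a (insert i S) ^ 2 else 0)) := by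
      unfold Nf
      refine Finset.sum_le_sum fun S _ => ?_
      unfold hco
      split_ifs <;> first | simp; done | (simp; positivity)
    refine h2.trans ?_
    rw [← sum_mem_reindex i (fun S => if T ⊆ S then r ^ (S \ T).card * a (insert i S) ^ 2 else 0)]
    unfold Nf
    refine Finset.sum_le_sum fun S _ => ?_
    by_cases hi : i ∈ S
    · simp only [hi, if_true, Finset.insert_erase hi]
      by_cases hT : T ⊆ S.erase i
      · have h3 : insert i T ⊆ S := by
          rw [Finset.insert_subset_iff]; exact ⟨hi, hT.trans (Finset.erase_subset _ _)⟩
        have h4 : S.erase i \ T = S \ insert i T := by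
          ext x; simp; tauto
        simp [hT, h3, h4]
      · simp only [hT, if_false]; split_ifs <;> positivity
    · simp only [hi, if_false]; split_ifs <;> positivity

def dd (f : (V → Bool) → ℝ) (i : V) (ω : V → Bool) : ℝ :=
  f (Function.update ω i true) - f (Function.update ω i false)

lemma kkl_i (h0 : 0 < p) (h1 : p ≤ 1/2) (k : ℕ) (f : (V → Bool) → ℝ) (a0 : Finset V → ℝ)
    (hf : ∀ ω, f ω = pol p a0 ω) (c t : ℝ) (hc : 0 < c) (ht : 0 < t) (hct : 2 * 64 ^ k * c ≤ t ^ 3) (i : V)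
    (hd : ∀ ω, dd f i ω = 0 ∨ dd f i ω = 1) :
    ∑ S, hco (BB (p / (1 - p)) (trunc k a0) c) i (trunc k a0) S ^ 2 * (p / (1 - p)) ^ S.card ≤ 2 * t * Ex p (dd f i) := by
  have hp1 : p < 1 := by linarith
  have hr : 0 ≤ p / (1 - p) := div_nonneg h0.le (by linarith)
  set r := p / (1 - p) with hrd
  set a := trunc k a0
  set hi := hco (BB r a c) i a with hhi
  have ha : ∀ S, k < S.card → hi S = 0 := by
    intro S hS
    simp only [hhi, hco]
    split_ifs with q1 q2
    · rfl
    · rfl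
    · exact trunc_zero k a0 _ (by rw [Finset.card_insert_of_notMem q1]; omega)
  have e4 := fourth_le h0.le h1 k hi ha c (fun T => Nf_hco r hr a c hc i T)
  have e2 := parseval (p := p) hp1 hi
  have e1 : Ex p (fun ω => pol p hi ω ^ 2) = (1 - p) * Ex p (fun ω => dd f i ω * pol p hi ω) := by
    have : (fun ω => (1 - p) * (dd f i ω * pol p hi ω)) = fun ω => pol p (dco i a0) ω * pol p hi ω := by
      funext ω
      rw [← pol_deriv hp1, dd, hf, hf]; ring
    rw [← Ex_const_mul, this, parseval2 hp1, e2]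
    refine Finset.sum_congr rfl fun S _ => ?_
    simp only [hhi, hco, dco, a, trunc]
    split_ifs <;> ring
  set m := Ex p (fun ω => pol p hi ω ^ 2) with hm
  have hm0 : 0 ≤ m := Ex_nonneg h0.le hp1.le fun ω => sq_nonneg _
  have e3 : Ex p (fun ω => dd f i ω * pol p hi ω) ≤ t * Ex p (dd f i) + (t ^ 3)⁻¹ * Ex p (fun ω => pol p hi ω ^ 4) := by
    rw [← Ex_const_mul, ← Ex_const_mul, ← Ex_add]
    refine Ex_mono h0.le hp1.le fun ω => ?_
    set x := pol p hi ω
    rcases hd ω with h | h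
    · rw [h]; simp only [zero_mul, mul_zero, zero_add]; positivity
    · rw [h]
      by_cases hx : x ≤ t
      · have : 0 ≤ (t ^ 3)⁻¹ * x ^ 4 := by positivity
        linarith
      · push Not at hx
        have : x ≤ (t ^ 3)⁻¹ * x ^ 4 := by
          rw [inv_mul_eq_div, le_div_iff₀ (by positivity)]
          have : t ^ 3 ≤ x ^ 3 := pow_le_pow_left₀ ht.le hx.le 3
          have hx0 : 0 ≤ x := by linarith
          nlinarith
        linarith
  have e5 : (t ^ 3)⁻¹ * Ex p (fun ω => pol p hi ω ^ 4) ≤ m / 2 := by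
    rw [inv_mul_eq_div, div_le_iff₀ (by positivity)]
    refine e4.trans ?_
    have := mul_le_mul_of_nonneg_right hct hm0
    nlinarith
  have hd0 : 0 ≤ Ex p (dd f i) := Ex_nonneg h0.le hp1.le fun ω => by rcases hd ω with h | h <;> simp [h]
  rw [← e2]
  have e6 : m ≤ t * Ex p (dd f i) + m / 2 := by
    rw [e1]
    have h7 : Ex p (fun ω => dd f i ω * pol p hi ω) ≤ t * Ex p (dd f i) + m / 2 := e3.trans (by linarith)
    have h8 : 0 ≤ t * Ex p (dd f i) + m / 2 := by positivity
    calc _ ≤ (1 - p) * (t * Ex p (dd f i) + m / 2) := mul_le_mul_of_nonneg_left h7 (by linarith)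
      _ ≤ 1 * (t * Ex p (dd f i) + m / 2) := mul_le_mul_of_nonneg_right (by linarith) h8
      _ = _ := by rw [one_mul, e1]
  linarith

lemma kkl (h0 : 0 < p) (h1 : p ≤ 1/2) (k : ℕ) (f : (V → Bool) → ℝ) (a0 : Finset V → ℝ)
    (hf : ∀ ω, f ω = pol p a0 ω) (c t : ℝ) (hc : 0 < c) (ht : 0 < t) (hct : 2 * 64 ^ k * c ≤ t ^ 3)
    (hd : ∀ i ω, dd f i ω = 0 ∨ dd f i ω = 1) :
    ∑ S, (if core (BB (p / (1 - p)) (trunc k a0) c) S = S then 0 else trunc k a0 S ^ 2 * (p / (1 - p)) ^ S.card) ≤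
      2 * t * ((p / (1 - p)) * ∑ i, Ex p (dd f i)) := by
  have hr : 0 ≤ p / (1 - p) := div_nonneg h0.le (by linarith)
  set r := p / (1 - p) with hrd
  set a := trunc k a0
  set B := BB r a c
  have s1 : ∀ i, r * ∑ S, hco B i a S ^ 2 * r ^ S.card = ∑ S : Finset V, if i ∈ S then (if i ∈ core B S then 0 else a S ^ 2 * r ^ S.card) else 0 := by
    intro i
    have e : ∀ S : Finset V, r * (hco B i a S ^ 2 * r ^ S.card) = if i ∈ S then 0 else (fun S => (if i ∈ core B (insert i S) then 0 else a (insert i S) ^ 2 * r ^ (insert i S).card)) S := by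
      intro S
      simp only [hco]
      split_ifs with h1 h2
      · simp
      · simp
      · rw [Finset.card_insert_of_notMem h1]; ring
    rw [Finset.mul_sum]
    simp only [e]
    rw [← sum_mem_reindex]
    refine Finset.sum_congr rfl fun S _ => ?_
    by_cases h : i ∈ S
    · simp [h]
    · simp [h]
  calc _ ≤ ∑ S : Finset V, ∑ i, (if i ∈ S then (if i ∈ core B S then 0 else a S ^ 2 * r ^ S.card) else 0) := by
        refine Finset.sum_le_sum fun S _ => ?_
        have hnn : ∀ i ∈ Finset.univ, 0 ≤ (if i ∈ S then (if i ∈ core B S then 0 else a S ^ 2 * r ^ S.card) else 0) := by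
          intro i _; split_ifs <;> positivity
        split_ifs with h
        · exact Finset.sum_nonneg hnn
        · have : ∃ i ∈ S, i ∉ core B S := by
            by_contra hcon
            push Not at hcon
            exact h ((core_subset _ _).antisymm hcon)
          obtain ⟨i, hi, hi2⟩ := this
          refine le_trans ?_ (Finset.single_le_sum hnn (Finset.mem_univ i))
          simp [hi, hi2]
    _ = ∑ i, r * ∑ S, hco B i a S ^ 2 * r ^ S.card := by
        rw [Finset.sum_comm]; refine Finset.sum_congr rfl fun i _ => (s1 i).symm
    _ ≤ ∑ i, r * (2 * t * Ex p (dd f i)) := by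
        refine Finset.sum_le_sum fun i _ => mul_le_mul_of_nonneg_left ?_ hr
        exact kkl_i h0 h1 k f a0 hf c t hc ht hct i (hd i)
    _ = _ := by
        rw [Finset.mul_sum, Finset.mul_sum]; refine Finset.sum_congr rfl fun i _ => by ring

lemma influence_pol (h0 : 0 < p) (h1 : p < 1) (f : (V → Bool) → ℝ) (a0 : Finset V → ℝ)
    (hf : ∀ ω, f ω = pol p a0 ω) (hd : ∀ i ω, dd f i ω = 0 ∨ dd f i ω = 1) :
    ∑ S, (S.card : ℝ) * (a0 S ^ 2 * (p / (1 - p)) ^ S.card) = p * (1 - p) * ∑ i, Ex p (dd f i) := by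
  have hq : 1 - p ≠ 0 := by linarith
  set r := p / (1 - p) with hrd
  have s1 : ∀ i, p * (1 - p) * Ex p (dd f i) = ∑ S : Finset V, if i ∈ S then a0 S ^ 2 * r ^ S.card else 0 := by
    intro i
    have e1 : (1 - p) ^ 2 * Ex p (dd f i) = Ex p (fun ω => pol p (dco i a0) ω ^ 2) := by
      rw [← Ex_const_mul]; congr 1; funext ω
      rw [← pol_deriv h1, ← hf, ← hf]
      have : dd f i ω = dd f i ω ^ 2 := by rcases hd i ω with h | h <;> rw [h] <;> norm_num
      rw [mul_pow, this]; rfl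
    have e2 : p * (1 - p) * Ex p (dd f i) = r * ((1 - p) ^ 2 * Ex p (dd f i)) := by
      rw [hrd]; field_simp
    rw [e2, e1, parseval h1, Finset.mul_sum]
    have e : ∀ S : Finset V, r * (dco i a0 S ^ 2 * r ^ S.card) = if i ∈ S then 0 else (fun S => (a0 (insert i S) ^ 2 * r ^ (insert i S).card)) S := by
      intro S
      simp only [dco]
      split_ifs with h1
      · simp
      · rw [Finset.card_insert_of_notMem h1]; ring
    have e' : ∀ S : Finset V, r * (dco i a0 S ^ 2 * (p / (1 - p)) ^ S.card) = if i ∈ S then 0 else (fun S => (a0 (insert i S) ^ 2 * r ^ (insert i S).card)) S := e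
    simp only [e']
    rw [← sum_mem_reindex]
    refine Finset.sum_congr rfl fun S _ => ?_
    by_cases h : i ∈ S
    · simp [h]
    · simp [h]
  rw [Finset.mul_sum]
  simp only [s1]
  rw [Finset.sum_comm]
  refine Finset.sum_congr rfl fun S _ => ?_
  simp [Finset.sum_ite_mem, Finset.sum_const]

lemma tail_le (h0 : 0 < p) (h1 : p < 1) (k : ℕ) (f : (V → Bool) → ℝ) (a0 : Finset V → ℝ)
    (hf : ∀ ω, f ω = pol p a0 ω) (hd : ∀ i ω, dd f i ω = 0 ∨ dd f i ω = 1) :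
    k * ∑ S : Finset V, (if S.card ≤ k then 0 else a0 S ^ 2 * (p / (1 - p)) ^ S.card) ≤ p * (1 - p) * ∑ i, Ex p (dd f i) := by
  have hr : 0 ≤ p / (1 - p) := div_nonneg h0.le (by linarith)
  rw [← influence_pol h0 h1 f a0 hf hd, Finset.mul_sum]
  refine Finset.sum_le_sum fun S _ => ?_
  split_ifs with h
  · simp; positivity
  · refine mul_le_mul_of_nonneg_right ?_ (by positivity)
    exact_mod_cast (by omega : k ≤ S.card)

lemma Nf_bound (h0 : 0 < p) (h1 : p < 1) (f : (V → Bool) → ℝ) (a0 : Finset V → ℝ)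
    (hf : ∀ ω, f ω = pol p a0 ω) (hb : ∀ ω, |f ω| ≤ 1) (T : Finset V) : Nf (p / (1 - p)) a0 T ≤ 4 ^ T.card := by
  have key : ∃ F : (V → Bool) → ℝ, (∀ ω, |F ω| ≤ 2 ^ T.card) ∧ ∀ ω, F ω = pol p (fun S => if Disjoint S T then a0 (S ∪ T) else 0) ω := by
    induction T using Finset.induction_on with
    | empty => exact ⟨f, by simpa using hb, by simpa using hf⟩
    | insert i T hi ih =>
      obtain ⟨F, hF1, hF2⟩ := ih
      refine ⟨fun ω => (1 - p) * (F (Function.update ω i true) - F (Function.update ω i false)), fun ω => ?_, fun ω => ?_⟩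
      · rw [abs_mul, Finset.card_insert_of_notMem hi, pow_succ, abs_of_pos (by linarith : 0 < 1 - p)]
        have b1 := hF1 (Function.update ω i true)
        have b2 := hF1 (Function.update ω i false)
        have b3 := abs_sub (F (Function.update ω i true)) (F (Function.update ω i false))
        have b4 := abs_nonneg (F (Function.update ω i true) - F (Function.update ω i false))
        nlinarith
      · simp only [hF2]
        rw [pol_deriv h1]
        congr 1
        funext S
        simp only [dco, Finset.disjoint_insert_left, Finset.disjoint_insert_right, Finset.union_insert, Finset.insert_union]
        by_cases hS : i ∈ S <;> simp [hS, hi]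
  obtain ⟨F, hF1, hF2⟩ := key
  have e1 : Nf (p / (1 - p)) a0 T = Ex p (fun ω => F ω ^ 2) := by
    simp only [hF2]
    rw [parseval h1, Nf, ← sum_superset_reindex T (fun S => (p / (1 - p)) ^ (S \ T).card * a0 S ^ 2)]
    rw [← Finset.sum_subset (Finset.subset_univ (Finset.univ \ T).powerset)]
    · refine Finset.sum_congr rfl fun S hS => ?_
      have : Disjoint S T := (Finset.disjoint_of_subset_left (Finset.mem_powerset.1 hS) Finset.sdiff_disjoint)
      simp only [Finset.union_sdiff_right, Finset.sdiff_eq_self_of_disjoint this, this, if_true]; ring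
    · intro S _ hS
      have : ¬ Disjoint S T := by
        intro hdis; apply hS; rw [Finset.mem_powerset]
        intro x hx; simp; exact fun hxT => (Finset.disjoint_left.1 hdis hx hxT)
      simp [this]
  rw [e1]
  calc _ ≤ Ex p (fun _ : V → Bool => (4:ℝ) ^ T.card) := Ex_mono h0.le h1.le fun ω => by
        have := hF1 ω
        rw [← sq_abs, show (4:ℝ) = 2 ^ 2 by norm_num, ← pow_mul, mul_comm, pow_mul]
        exact pow_le_pow_left₀ (abs_nonneg _) this 2
    _ = _ := Ex_const _

lemma Nf_trunc_le {r : ℝ} (hr : 0 ≤ r) (k : ℕ) (a0 : Finset V → ℝ) (T : Finset V) : Nf r (trunc k a0) T ≤ Nf r a0 T := by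
  unfold Nf
  refine Finset.sum_le_sum fun S _ => ?_
  unfold trunc
  split_ifs <;> simp <;> positivity
end gen

section gen
variable {V : Type*} [Fintype V] [DecidableEq V] {p : ℝ}

lemma sumB {r : ℝ} (hr : 0 ≤ r) (k : ℕ) (a : Finset V → ℝ) (ha : ∀ S, k < S.card → a S = 0) {c : ℝ} (hc : 0 < c)
    (Y : Finset V) (P : Finset (Finset V)) (𝒯 : Finset (Finset V))
    (h : ∀ T ∈ 𝒯, T ∈ BB r a c ∧ T ∩ Y ∈ P) :
    ∑ T ∈ 𝒯, r ^ (T \ Y).card ≤ c⁻¹ * 2 ^ k * ∑ Z ∈ P, Nf r a Z := by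
  have h1 : ∀ T ∈ 𝒯, r ^ (T \ Y).card ≤ ∑ Z ∈ P, if Z ⊆ T then c⁻¹ * ((1 * r) ^ (T \ Z).card * Nf r a T) else 0 := by
    intro T hT
    obtain ⟨hB, hP⟩ := h T hT
    have hN : c ≤ Nf r a T := by
      simp only [BB, Finset.mem_filter] at hB; exact hB.2.2
    have hle : r ^ (T \ Y).card ≤ if T ∩ Y ⊆ T then c⁻¹ * ((1 * r) ^ (T \ (T ∩ Y)).card * Nf r a T) else 0 := by
      rw [if_pos Finset.inter_subset_left, Finset.sdiff_inter_self_left, one_mul]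
      have h1c : 1 ≤ c⁻¹ * Nf r a T := by
        rw [inv_mul_eq_div, le_div_iff₀ hc]; linarith
      have h0 : 0 ≤ r ^ (T \ Y).card := by positivity
      nlinarith
    refine hle.trans ?_
    refine Finset.single_le_sum (f := fun Z => if Z ⊆ T then c⁻¹ * ((1 * r) ^ (T \ Z).card * Nf r a T) else 0) (fun Z _ => ?_) hP
    have := Nf_nonneg hr a T
    split_ifs <;> positivity
  refine (Finset.sum_le_sum h1).trans ?_
  rw [Finset.sum_comm, Finset.mul_sum]
  refine Finset.sum_le_sum fun Z _ => ?_
  have h2 := sum_T_Nf r hr 1 zero_le_one k a ha Z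
  have h3 : ∑ T ∈ 𝒯, (if Z ⊆ T then c⁻¹ * ((1 * r) ^ (T \ Z).card * Nf r a T) else 0) ≤
      ∑ T : Finset V, (if Z ⊆ T then c⁻¹ * ((1 * r) ^ (T \ Z).card * Nf r a T) else 0) := by
    refine Finset.sum_le_sum_of_subset_of_nonneg (Finset.subset_univ _) fun T _ _ => ?_
    have := Nf_nonneg hr a T
    split_ifs <;> positivity
  refine h3.trans ?_
  have h4 : ∑ T : Finset V, (if Z ⊆ T then c⁻¹ * ((1 * r) ^ (T \ Z).card * Nf r a T) else 0) =
     c⁻¹ * ∑ T : Finset V, (if Z ⊆ T then ((1 * r) ^ (T \ Z).card * Nf r a T) else 0) := by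
    rw [Finset.mul_sum]; refine Finset.sum_congr rfl fun T _ => by split_ifs <;> simp
  rw [h4, mul_assoc]
  refine mul_le_mul_of_nonneg_left (h2.trans (by norm_num)) (by positivity)

def CC (B : Finset (Finset V)) (k : ℕ) : Finset (Finset V) :=
  Finset.univ.filter fun S => S.card ≤ k ∧ core B S = S

def QQ (r : ℝ) (C : Finset (Finset V)) (Y : Finset V) : ℝ := ∑ S ∈ C, if Y ⊆ S then r ^ (S \ Y).card else 0

lemma QQ_nonneg {r : ℝ} (hr : 0 ≤ r) (C : Finset (Finset V)) (Y : Finset V) : 0 ≤ QQ r C Y :=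
  Finset.sum_nonneg fun S _ => by split_ifs <;> positivity

lemma QQ_zero {r : ℝ} (B : Finset (Finset V)) (k : ℕ) (Y : Finset V) (h : k < Y.card) : QQ r (CC B k) Y = 0 := by
  refine Finset.sum_eq_zero fun S hS => ?_
  simp only [CC, Finset.mem_filter] at hS
  rw [if_neg]
  intro h2
  have := Finset.card_le_card h2
  omega

lemma QQ_rec {r : ℝ} (hr : 0 ≤ r) (C : Finset (Finset V)) (Y : Finset V) (e : ℝ) (he : 0 ≤ e) (𝒯 : Finset (Finset V))
    (h : ∀ S ∈ C, Y ⊆ S → (S = Y ∧ 1 ≤ e) ∨ ∃ T ∈ 𝒯, T ⊆ S) :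
    QQ r C Y ≤ e + ∑ T ∈ 𝒯, r ^ (T \ Y).card * QQ r C (Y ∪ T) := by
  have h1 : ∀ S ∈ C, (if Y ⊆ S then r ^ (S \ Y).card else 0) ≤
      (if S = Y then e else 0) + ∑ T ∈ 𝒯, r ^ (T \ Y).card * (if Y ∪ T ⊆ S then r ^ (S \ (Y ∪ T)).card else 0) := by
    intro S hS
    have hnn : 0 ≤ ∑ T ∈ 𝒯, r ^ (T \ Y).card * (if Y ∪ T ⊆ S then r ^ (S \ (Y ∪ T)).card else 0) :=
      Finset.sum_nonneg fun T _ => by split_ifs <;> positivity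
    by_cases hYS : Y ⊆ S
    · rw [if_pos hYS]
      rcases h S hS hYS with ⟨h1, h2⟩ | ⟨T, hT, hTS⟩
      · subst h1; simp only [Finset.sdiff_self, Finset.card_empty, pow_zero, if_true]; linarith
      · have : r ^ (S \ Y).card = r ^ (T \ Y).card * (if Y ∪ T ⊆ S then r ^ (S \ (Y ∪ T)).card else 0) := by
          rw [if_pos (Finset.union_subset hYS hTS), ← pow_add]
          congr 1
          rw [← Finset.card_union_of_disjoint]
          · congr 1
            ext x; simp only [Finset.mem_sdiff, Finset.mem_union]
            have := @hTS x
            tauto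
          · rw [Finset.disjoint_left]; intro x; simp only [Finset.mem_sdiff, Finset.mem_union]; tauto
        rw [this]
        have h5 := Finset.single_le_sum (f := fun T => r ^ (T \ Y).card * (if Y ∪ T ⊆ S then r ^ (S \ (Y ∪ T)).card else 0)) (fun T _ => by split_ifs <;> positivity) hT
        refine h5.trans ?_
        have : (0:ℝ) ≤ if S = Y then e else 0 := by split_ifs <;> simp [he]
        linarith
    · rw [if_neg hYS]
      have : (0:ℝ) ≤ if S = Y then e else 0 := by split_ifs <;> simp [he]
      linarith
  refine (Finset.sum_le_sum h1).trans ?_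
  rw [Finset.sum_add_distrib, Finset.sum_comm]
  refine add_le_add ?_ (le_of_eq ?_)
  · rw [Finset.sum_ite_eq' C Y]; split_ifs <;> simp [he]
  · refine Finset.sum_congr rfl fun T _ => ?_
    rw [QQ, Finset.mul_sum]

lemma QQ_bound {r : ℝ} (hr : 0 ≤ r) (k : ℕ) (a : Finset V → ℝ) (ha : ∀ S, k < S.card → a S = 0) {c : ℝ} (hc : 0 < c)
    (hN : ∀ T, Nf r a T ≤ 4 ^ T.card) (d : ℕ) : ∀ Y : Finset V, k < Y.card + d →
    QQ r (CC (BB r a c) k) Y ≤ (1 + 16 ^ k / c) ^ d := by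
  have hΘ : 0 ≤ 16 ^ k / c := by positivity
  induction d with
  | zero => intro Y h; rw [QQ_zero _ _ _ (by simpa using h)]; simp
  | succ d ih =>
    intro Y hY
    by_cases hk : k < Y.card
    · rw [QQ_zero _ _ _ hk]; positivity
    push Not at hk
    have h1 := QQ_rec hr (CC (BB r a c) k) Y 1 zero_le_one ((BB r a c).filter fun T => ¬ T ⊆ Y) (by
      intro S hS hYS
      by_cases h : S = Y
      · left; exact ⟨h, le_rfl⟩
      · right
        have : ∃ x ∈ S, x ∉ Y := by
          by_contra hcon; push Not at hcon; exact h (Finset.Subset.antisymm hcon hYS)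
        obtain ⟨x, hx, hxY⟩ := this
        simp only [CC, Finset.mem_filter] at hS
        rw [← hS.2.2, mem_core] at hx
        obtain ⟨T, h1, h2, h3⟩ := hx
        exact ⟨T, Finset.mem_filter.2 ⟨h1, fun h => hxY (h h3)⟩, h2⟩)
    have h2 : ∑ T ∈ (BB r a c).filter (fun T => ¬ T ⊆ Y), r ^ (T \ Y).card * QQ r (CC (BB r a c) k) (Y ∪ T) ≤
       ∑ T ∈ (BB r a c).filter (fun T => ¬ T ⊆ Y), r ^ (T \ Y).card * (1 + 16 ^ k / c) ^ d := by
      refine Finset.sum_le_sum fun T hT => ?_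
      refine mul_le_mul_of_nonneg_left (ih _ ?_) (by positivity)
      simp only [Finset.mem_filter] at hT
      have : Y.card < (Y ∪ T).card := by
        refine Finset.card_lt_card ⟨Finset.subset_union_left, fun h => hT.2 (Finset.subset_union_right.trans h)⟩
      omega
    have h3 := sumB hr k a ha hc Y Y.powerset ((BB r a c).filter (fun T => ¬ T ⊆ Y)) (by
      intro T hT
      simp only [Finset.mem_filter] at hT
      exact ⟨hT.1, by simp⟩)
    have h4 : ∑ Z ∈ Y.powerset, Nf r a Z ≤ 8 ^ k := by
      have : ∀ Z ∈ Y.powerset, Nf r a Z ≤ 4 ^ k := by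
        intro Z hZ
        refine (hN Z).trans (pow_le_pow_right₀ (by norm_num) ?_)
        exact (Finset.card_le_card (Finset.mem_powerset.1 hZ)).trans hk
      refine (Finset.sum_le_card_nsmul _ _ _ this).trans ?_
      rw [Finset.card_powerset, nsmul_eq_mul]
      push_cast
      have : (2:ℝ) ^ Y.card ≤ 2 ^ k := pow_le_pow_right₀ (by norm_num) hk
      calc (2:ℝ) ^ Y.card * 4 ^ k ≤ 2 ^ k * 4 ^ k := by gcongr
        _ = 8 ^ k := by rw [← mul_pow]; norm_num
    have h5 : c⁻¹ * 2 ^ k * ∑ Z ∈ Y.powerset, Nf r a Z ≤ 16 ^ k / c := by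
      calc _ ≤ c⁻¹ * 2 ^ k * 8 ^ k := by gcongr
        _ = 16 ^ k / c := by rw [mul_assoc, ← mul_pow]; norm_num; ring
    rw [← Finset.sum_mul] at h2
    have h6 := h3.trans h5
    have h7 : 1 ≤ (1 + 16 ^ k / c) ^ d := one_le_pow₀ (by linarith)
    have h8 : (∑ T ∈ (BB r a c).filter (fun T => ¬ T ⊆ Y), r ^ (T \ Y).card) * (1 + 16 ^ k / c) ^ d ≤ (16 ^ k / c) * (1 + 16 ^ k / c) ^ d := by gcongr
    rw [pow_succ]
    nlinarith

lemma QQ_small {r : ℝ} (hr : 0 ≤ r) (k : ℕ) (a : Finset V → ℝ) (ha : ∀ S, k < S.card → a S = 0) {c c2 : ℝ} (hc : 0 < c) (hc2 : 0 < c2)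
    (hN : ∀ T, Nf r a T ≤ 4 ^ T.card) (Z : Finset V) (hZ : core (BB r a c2) Z ≠ Z) :
    QQ r (CC (BB r a c) k) Z ≤ (1 + 16 ^ k / c) ^ (k+1) * (c⁻¹ * 4 ^ k * c2) := by
  by_cases hk : k < Z.card
  · rw [QQ_zero _ _ _ hk]; positivity
  push Not at hk
  have : ∃ i ∈ Z, i ∉ core (BB r a c2) Z := by
    by_contra hcon; push Not at hcon; exact hZ (Finset.Subset.antisymm (core_subset _ _) hcon)
  obtain ⟨i, hi, hic⟩ := this
  have h1 := QQ_rec hr (CC (BB r a c) k) Z 0 le_rfl ((BB r a c).filter fun T => i ∈ T) (by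
      intro S hS hYS
      right
      have hx := hYS hi
      simp only [CC, Finset.mem_filter] at hS
      rw [← hS.2.2, mem_core] at hx
      obtain ⟨T, h1, h2, h3⟩ := hx
      exact ⟨T, Finset.mem_filter.2 ⟨h1, h3⟩, h2⟩)
  rw [zero_add] at h1
  refine h1.trans ?_
  have h2 : ∑ T ∈ (BB r a c).filter (fun T => i ∈ T), r ^ (T \ Z).card * QQ r (CC (BB r a c) k) (Z ∪ T) ≤
       ∑ T ∈ (BB r a c).filter (fun T => i ∈ T), r ^ (T \ Z).card * (1 + 16 ^ k / c) ^ (k+1) := by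
    refine Finset.sum_le_sum fun T hT => ?_
    refine mul_le_mul_of_nonneg_left (QQ_bound hr k a ha hc hN _ _ (by omega)) (by positivity)
  refine h2.trans ?_
  rw [← Finset.sum_mul, mul_comm]
  refine mul_le_mul_of_nonneg_left ?_ (by positivity)
  have h3 := sumB hr k a ha hc Z (Z.powerset.filter fun P => Nf r a P ≤ c2) ((BB r a c).filter (fun T => i ∈ T)) (by
      intro T hT
      simp only [Finset.mem_filter] at hT
      refine ⟨hT.1, ?_⟩
      simp only [Finset.mem_filter, Finset.mem_powerset]
      refine ⟨Finset.inter_subset_right, ?_⟩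
      by_contra hcon
      apply hic
      rw [mem_core]
      refine ⟨T ∩ Z, ?_, Finset.inter_subset_right, by simp [hT.2, hi]⟩
      simp only [BB, Finset.mem_filter, Finset.mem_univ, true_and]
      refine ⟨?_, by linarith⟩
      apply Finset.ne_empty_of_mem (a := i); simp [hT.2, hi])
  refine h3.trans ?_
  have h4 : ∑ P ∈ Z.powerset.filter (fun P => Nf r a P ≤ c2), Nf r a P ≤ 2 ^ k * c2 := by
    refine (Finset.sum_le_card_nsmul _ _ c2 (fun P hP => (Finset.mem_filter.1 hP).2)).trans ?_
    rw [nsmul_eq_mul]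
    have : ((Z.powerset.filter fun P => Nf r a P ≤ c2).card : ℝ) ≤ 2 ^ k := by
      have h5 : (Z.powerset.filter fun P => Nf r a P ≤ c2).card ≤ 2 ^ k := by
        refine (Finset.card_filter_le _ _).trans ?_
        rw [Finset.card_powerset]
        exact pow_le_pow_right₀ (by norm_num) hk
      exact_mod_cast h5
    gcongr
  calc _ ≤ c⁻¹ * 2 ^ k * (2 ^ k * c2) := by gcongr
    _ = _ := by rw [show (4:ℝ) = 2 * 2 by norm_num, mul_pow]; ring

def xm (W : Finset V) (ω : V → Bool) : ℝ := ∏ i ∈ W, if ω i then 1 else 0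

lemma phi_xm (hp : p < 1) (S : Finset V) (ω : V → Bool) :
    phi p S ω = ((1 - p) ^ S.card)⁻¹ * ∑ W ∈ S.powerset, (-p) ^ (S \ W).card * xm W ω := by
  have hq : 1 - p ≠ 0 := by linarith
  have h1 : ∀ i, ph p (ω i) = (1 - p)⁻¹ * ((if ω i then 1 else 0) + (-p)) := by
    intro i; unfold ph; split_ifs <;> field_simp <;> ring
  unfold phi
  simp only [h1]
  rw [Finset.prod_mul_distrib, Finset.prod_const, inv_pow, Finset.prod_add]
  congr 1
  refine Finset.sum_congr rfl fun W _ => ?_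
  rw [Finset.prod_const, xm, mul_comm]

lemma xm_phi (hp : p < 1) (W : Finset V) (ω : V → Bool) :
    xm W ω = ∑ Z ∈ W.powerset, p ^ (W \ Z).card * (1 - p) ^ Z.card * phi p Z ω := by
  have hq : 1 - p ≠ 0 := by linarith
  have h1 : ∀ i, (if ω i then (1:ℝ) else 0) = (1 - p) * ph p (ω i) + p := by
    intro i; unfold ph; split_ifs <;> field_simp <;> ring
  unfold xm
  simp only [h1]
  rw [Finset.prod_add]
  refine Finset.sum_congr rfl fun Z _ => ?_
  rw [Finset.prod_const, Finset.prod_mul_distrib, Finset.prod_const, phi]; ring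

lemma xm_diff (hp : p < 1) (W C : Finset V) (hC : C ⊆ W) (ω : V → Bool) :
    xm W ω - p ^ (W \ C).card * xm C ω =
     ∑ Z : Finset V, (if Z ⊆ W ∧ ¬ Z ⊆ C then p ^ (W \ Z).card * (1 - p) ^ Z.card else 0) * phi p Z ω := by
  have h1 : ∀ Z : Finset V, (if Z ⊆ W ∧ ¬ Z ⊆ C then p ^ (W \ Z).card * (1 - p) ^ Z.card else 0) * phi p Z ω =
    (if Z ∈ W.powerset then p ^ (W \ Z).card * (1 - p) ^ Z.card * phi p Z ω else 0) -
     (if Z ∈ C.powerset then p ^ (W \ C).card * (p ^ (C \ Z).card * (1 - p) ^ Z.card * phi p Z ω) else 0) := by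
    intro Z
    simp only [Finset.mem_powerset]
    by_cases h : Z ⊆ C
    · have h2 := h.trans hC
      simp only [h, h2, not_true, and_false, if_false, if_true]
      have : (W \ Z).card = (W \ C).card + (C \ Z).card := by
        rw [Finset.card_sdiff_of_subset h2, Finset.card_sdiff_of_subset hC, Finset.card_sdiff_of_subset h]
        have := Finset.card_le_card h
        have := Finset.card_le_card hC
        omega
      rw [this, pow_add]; ring
    · by_cases h2 : Z ⊆ W <;> simp [h, h2]
  simp only [h1]
  rw [Finset.sum_sub_distrib, Finset.sum_ite_mem, Finset.sum_ite_mem, Finset.univ_inter, Finset.univ_inter, ← Finset.mul_sum, ← xm_phi hp, ← xm_phi hp]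

def Gf (p : ℝ) (B C : Finset (Finset V)) (a : Finset V → ℝ) (ω : V → Bool) : ℝ :=
  ∑ S ∈ C, a S * (((1 - p) ^ S.card)⁻¹ * ∑ W ∈ S.powerset, (-p) ^ (S \ W).card * (p ^ (W \ core B W).card * xm (core B W) ω))

def rho (p : ℝ) (B C : Finset (Finset V)) (a : Finset V → ℝ) (Z : Finset V) : ℝ :=
  ∑ S ∈ C, a S * (((1 - p) ^ S.card)⁻¹ * ∑ W ∈ S.powerset, (-p) ^ (S \ W).card *
    (if Z ⊆ W ∧ ¬ Z ⊆ core B W then p ^ (W \ Z).card * (1 - p) ^ Z.card else 0))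

lemma g_sub_G (hp : p < 1) (B C : Finset (Finset V)) (a : Finset V → ℝ) (ω : V → Bool) :
    ∑ S ∈ C, a S * phi p S ω - Gf p B C a ω = pol p (rho p B C a) ω := by
  have : pol p (rho p B C a) ω = ∑ S ∈ C, a S * (((1 - p) ^ S.card)⁻¹ * ∑ W ∈ S.powerset, (-p) ^ (S \ W).card *
     (xm W ω - p ^ (W \ core B W).card * xm (core B W) ω)) := by
    simp only [fun W => xm_diff hp W (core B W) (core_subset B W) ω]
    unfold pol rho
    simp only [Finset.sum_mul, Finset.mul_sum]
    rw [Finset.sum_comm]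
    refine Finset.sum_congr rfl fun S _ => ?_
    rw [Finset.sum_comm]
    refine Finset.sum_congr rfl fun W _ => ?_
    refine Finset.sum_congr rfl fun Z _ => ?_
    ring
  rw [this, Gf, ← Finset.sum_sub_distrib]
  refine Finset.sum_congr rfl fun S _ => ?_
  rw [phi_xm hp, ← mul_sub, ← mul_sub, ← Finset.sum_sub_distrib]
  congr 2
  refine Finset.sum_congr rfl fun W _ => by ring

lemma rho_le (h0 : 0 ≤ p) (hp : p < 1) (B C : Finset (Finset V)) (a : Finset V → ℝ) (k : ℕ) (hC : ∀ S ∈ C, S.card ≤ k) (Z : Finset V) :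
    |rho p B C a Z| ≤ if core B Z = Z then 0 else 2 ^ k * ∑ S ∈ C, if Z ⊆ S then |a S| * (p / (1 - p)) ^ (S \ Z).card else 0 := by
  have hq : 0 < 1 - p := by linarith
  split_ifs with h
  · rw [abs_nonpos_iff]
    refine Finset.sum_eq_zero fun S _ => ?_
    rw [Finset.sum_eq_zero, mul_zero, mul_zero]
    intro W _
    rw [if_neg, mul_zero]
    rintro ⟨h1, h2⟩
    apply h2; rw [← h]; exact core_mono B h1
  · rw [Finset.mul_sum]
    refine (Finset.abs_sum_le_sum_abs _ _).trans (Finset.sum_le_sum fun S hS => ?_)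
    rw [abs_mul, abs_mul, abs_inv, abs_of_pos (pow_pos hq _)]
    have hW : ∀ W ∈ S.powerset, |(-p) ^ (S \ W).card * (if Z ⊆ W ∧ ¬ Z ⊆ core B W then p ^ (W \ Z).card * (1 - p) ^ Z.card else 0)|
       ≤ if Z ⊆ S then p ^ (S \ Z).card * (1 - p) ^ Z.card else 0 := by
      intro W hW
      rw [Finset.mem_powerset] at hW
      by_cases h1 : Z ⊆ W
      · rw [if_pos (h1.trans hW), abs_mul, abs_pow, abs_neg, abs_of_nonneg h0]
        have e : (S \ Z).card = (S \ W).card + (W \ Z).card := by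
          rw [Finset.card_sdiff_of_subset (h1.trans hW), Finset.card_sdiff_of_subset hW, Finset.card_sdiff_of_subset h1]
          have := Finset.card_le_card h1
          have := Finset.card_le_card hW
          omega
        rw [e, pow_add, mul_assoc]
        refine mul_le_mul_of_nonneg_left ?_ (by positivity)
        split_ifs
        · rw [abs_of_nonneg (by positivity)]
        · simp; positivity
      · rw [if_neg (by tauto), mul_zero, abs_zero]; split_ifs <;> positivity
    have h2 := (Finset.abs_sum_le_sum_abs _ _).trans (Finset.sum_le_sum hW)
    rw [Finset.sum_const, Finset.card_powerset, nsmul_eq_mul] at h2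
    by_cases hZS : Z ⊆ S
    · rw [if_pos hZS] at h2 ⊢
      have e : ((1 - p) ^ S.card)⁻¹ * (p ^ (S \ Z).card * (1 - p) ^ Z.card) = (p / (1 - p)) ^ (S \ Z).card := by
        have : S.card = (S \ Z).card + Z.card := by
          rw [Finset.card_sdiff_of_subset hZS]; have := Finset.card_le_card hZS; omega
        rw [this, pow_add, div_pow]; field_simp
      have h3 : ((2 ^ S.card : ℕ) : ℝ) ≤ 2 ^ k := by
        push_cast; exact pow_le_pow_right₀ (by norm_num) (hC S hS)
      calc _ ≤ |a S| * (((1 - p) ^ S.card)⁻¹ * (((2 ^ S.card : ℕ) : ℝ) * (p ^ (S \ Z).card * (1 - p) ^ Z.card))) := by gcongr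
        _ ≤ |a S| * (((1 - p) ^ S.card)⁻¹ * (2 ^ k * (p ^ (S \ Z).card * (1 - p) ^ Z.card))) := by gcongr
        _ = _ := by rw [← e]; ring
    · rw [if_neg hZS] at h2 ⊢
      have : |∑ W ∈ S.powerset, (-p) ^ (S \ W).card * (if Z ⊆ W ∧ ¬ Z ⊆ core B W then p ^ (W \ Z).card * (1 - p) ^ Z.card else 0)| = 0 := by
        apply le_antisymm (by simpa using h2) (abs_nonneg _)
      rw [this]; simp

lemma proj_bound (h0 : 0 ≤ p) (hp : p < 1) (k : ℕ) (a : Finset V → ℝ) (ha : ∀ S, k < S.card → a S = 0) {c c2 : ℝ} (hc : 0 < c) (hc2 : 0 < c2)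
    (hN : ∀ T, Nf (p / (1 - p)) a T ≤ 4 ^ T.card) :
    Ex p (fun ω => (∑ S ∈ CC (BB (p / (1 - p)) a c) k, a S * phi p S ω - Gf p (BB (p / (1 - p)) a c2) (CC (BB (p / (1 - p)) a c) k) a ω) ^ 2)
      ≤ 8 ^ k * ((1 + 16 ^ k / c) ^ (k+1) * (c⁻¹ * 4 ^ k * c2)) := by
  have hr : 0 ≤ p / (1 - p) := div_nonneg h0 (by linarith)
  simp only [g_sub_G hp]
  rw [parseval hp]
  set r := p / (1 - p) with hrd
  set C := CC (BB r a c) k with hCd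
  have hCk : ∀ S ∈ C, S.card ≤ k := by
    intro S hS; simp only [hCd, CC, Finset.mem_filter] at hS; exact hS.2.1
  set M := (1 + 16 ^ k / c) ^ (k+1) * (c⁻¹ * 4 ^ k * c2) with hM
  have hM0 : 0 ≤ M := by positivity
  have h1 : ∀ Z, rho p (BB r a c2) C a Z ^ 2 ≤ 4 ^ k * (M * Nf r a Z) := by
    intro Z
    have h2 := rho_le h0 hp (BB r a c2) C a k hCk Z
    rw [← hrd] at h2
    have hNZ := Nf_nonneg hr a Z
    split_ifs at h2 with h
    · rw [abs_nonpos_iff] at h2; rw [h2]; simp; positivity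
    · rw [← sq_abs]
      have hs0 : 0 ≤ ∑ S ∈ C, if Z ⊆ S then |a S| * r ^ (S \ Z).card else 0 :=
        Finset.sum_nonneg fun S _ => by split_ifs <;> positivity
      have h3 : (∑ S ∈ C, if Z ⊆ S then |a S| * r ^ (S \ Z).card else 0) ^ 2 ≤ QQ r C Z * Nf r a Z := by
        have h4 := Finset.sum_sq_le_sum_mul_sum_of_sq_eq_mul C (r := fun S => if Z ⊆ S then |a S| * r ^ (S \ Z).card else 0)
          (f := fun S => if Z ⊆ S then r ^ (S \ Z).card else 0) (g := fun S => if Z ⊆ S then r ^ (S \ Z).card * a S ^ 2 else 0)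
          (fun S _ => by split_ifs <;> positivity) (fun S _ => by split_ifs <;> positivity)
          (fun S _ => by
            split_ifs
            · rw [mul_pow, sq_abs]; ring
            · simp)
        refine h4.trans ?_
        refine mul_le_mul_of_nonneg_left ?_ (QQ_nonneg hr C Z)
        exact Finset.sum_le_sum_of_subset_of_nonneg (Finset.subset_univ _) fun S _ _ => by split_ifs <;> positivity
      have h5 := QQ_small hr k a ha hc hc2 hN Z h
      calc |rho p (BB r a c2) C a Z| ^ 2 ≤ (2 ^ k * ∑ S ∈ C, if Z ⊆ S then |a S| * r ^ (S \ Z).card else 0) ^ 2 := by gcongr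
        _ = 4 ^ k * (∑ S ∈ C, if Z ⊆ S then |a S| * r ^ (S \ Z).card else 0) ^ 2 := by
          rw [mul_pow, ← pow_mul, mul_comm k 2, pow_mul]; norm_num
        _ ≤ 4 ^ k * (M * Nf r a Z) := by
          refine mul_le_mul_of_nonneg_left (h3.trans ?_) (by positivity)
          exact mul_le_mul_of_nonneg_right h5 hNZ
  have h6 := sum_T_Nf r hr 1 zero_le_one k a ha ∅
  calc _ ≤ ∑ Z : Finset V, 4 ^ k * (M * Nf r a Z) * r ^ Z.card := by
        refine Finset.sum_le_sum fun Z _ => ?_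
        exact mul_le_mul_of_nonneg_right (h1 Z) (by positivity)
    _ = 4 ^ k * M * ∑ Z : Finset V, (if ∅ ⊆ Z then (1 * r) ^ (Z \ ∅).card * Nf r a Z else 0) := by
        rw [Finset.mul_sum]; refine Finset.sum_congr rfl fun Z _ => ?_
        simp; ring
    _ ≤ 4 ^ k * M * ((1 + 1) ^ k * Nf r a ∅) := by gcongr
    _ ≤ 4 ^ k * M * ((1 + 1) ^ k * 1) := by
        have := hN ∅
        simp at this
        gcongr
    _ = 8 ^ k * M := by
        rw [show (8:ℝ) = 4 * (1 + 1) by norm_num, mul_pow]; ring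
end gen

section gen
variable {V : Type*} [Fintype V] [DecidableEq V] {p : ℝ}

lemma w_lattice (ω η : V → Bool) : (∏ i, bw p (ω i)) * (∏ i, bw p (η i)) = (∏ i, bw p ((ω ⊓ η) i)) * ∏ i, bw p ((ω ⊔ η) i) := by
  rw [← Finset.prod_mul_distrib, ← Finset.prod_mul_distrib]
  refine Finset.prod_congr rfl fun i _ => ?_
  simp only [Pi.inf_apply, Pi.sup_apply]
  cases ω i <;> cases η i <;> simp [bw] <;> ring

lemma harris (h0 : 0 ≤ p) (h1 : p ≤ 1) (f g : (V → Bool) → ℝ) (hf0 : ∀ ω, 0 ≤ f ω) (hg0 : ∀ ω, 0 ≤ g ω)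
    (hf : Monotone f) (hg : Monotone g) : Ex p f * Ex p g ≤ Ex p (fun ω => f ω * g ω) := by
  have := fkg (μ := fun ω : V → Bool => ∏ i, bw p (ω i)) (f := f) (g := g) (fun ω => w_nonneg h0 h1 ω) hf0 hg0 hf hg
    (fun a b => (w_lattice a b).le)
  have h2 : ∑ ω : V → Bool, ∏ i, bw p (ω i) = 1 := by
    have := Ex_one (V := V) (p := p)
    simpa [Ex] using this
  rw [h2, one_mul] at this
  exact this

def up (T : Finset V) (ω : V → Bool) : V → Bool := fun i => ω i || decide (i ∈ T)

lemma up_mono (T : Finset V) : Monotone (up T) := by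
  intro ω η h i
  have := h i
  simp only [up]
  revert this
  cases ω i <;> cases η i <;> simp

lemma le_up (T : Finset V) (ω : V → Bool) : ω ≤ up T ω := by
  intro i; simp only [up]; cases ω i <;> simp

lemma up_mono_left {S T : Finset V} (h : S ⊆ T) (ω : V → Bool) : up S ω ≤ up T ω := by
  intro i; simp only [up]; have := @h i; cases ω i <;> by_cases h1 : i ∈ S <;> simp [h1, this]

def supp (ω : V → Bool) : Finset V := Finset.univ.filter fun i => ω i = true

lemma xm_eq (W : Finset V) (ω : V → Bool) : xm W ω = if W ⊆ supp ω then 1 else 0 := by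
  unfold xm
  rw [Finset.prod_ite_zero]
  simp [supp, Finset.subset_iff]

lemma xm_nonneg (W : Finset V) (ω : V → Bool) : 0 ≤ xm W ω := by rw [xm_eq]; split_ifs <;> simp

lemma up_of_subset {W : Finset V} {ω : V → Bool} (h : W ⊆ supp ω) : up W ω = ω := by
  funext i
  simp only [up]
  by_cases h1 : i ∈ W
  · have := h h1; simp [supp] at this; simp [this]
  · simp [h1]

lemma supp_mono {ω η : V → Bool} (h : ω ≤ η) : supp ω ⊆ supp η := by
  intro i; simp only [supp, Finset.mem_filter, Finset.mem_univ, true_and]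
  intro h1; have := h i; rw [h1] at this; exact top_le_iff.1 this

lemma Ex_xm (T : Finset V) : ∀ F : (V → Bool) → ℝ, Ex p (fun ω => xm T ω * F (up T ω)) = p ^ T.card * Ex p (fun ω => F (up T ω)) := by
  induction T using Finset.induction_on with
  | empty => intro F; simp [xm]
  | insert i T hi ih =>
    intro F
    rw [Ex_resample i]
    have e1 : ∀ ω, xm (insert i T) (Function.update ω i true) = xm T ω := by
      intro ω; unfold xm; rw [Finset.prod_insert hi]; simp
      refine Finset.prod_congr rfl fun j hj => ?_
      rw [Function.update_of_ne]; rintro rfl; exact hi hj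
    have e2 : ∀ ω, xm (insert i T) (Function.update ω i false) = 0 := by
      intro ω; unfold xm; rw [Finset.prod_insert hi]; simp
    have e3 : ∀ ω, up (insert i T) (Function.update ω i true) = up {i} (up T ω) := by
      intro ω; funext j; simp only [up]
      by_cases h : j = i
      · subst h; simp
      · simp [h]
    have e4 : ∀ ω, up (insert i T) ω = up {i} (up T ω) := by
      intro ω; funext j; simp only [up]
      by_cases h : j = i
      · subst h; simp
      · simp [h]
    simp only [e1, e2, e3, zero_mul, mul_zero, add_zero]
    rw [Ex_const_mul, ih (fun η => F (up {i} η)), Finset.card_insert_of_notMem hi]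
    simp only [e4]
    ring

lemma Ex_xm' (T : Finset V) (F : (V → Bool) → ℝ) : Ex p (fun ω => xm T ω * F ω) = p ^ T.card * Ex p (fun ω => F (up T ω)) := by
  rw [← Ex_xm]
  congr 1; funext ω
  rw [xm_eq]; split_ifs with h
  · rw [up_of_subset h]
  · simp

lemma Ex_xm_one (T : Finset V) : Ex p (fun ω => xm T ω) = p ^ T.card := by
  have := Ex_xm' (p := p) T (fun _ => 1)
  simpa [Ex_one] using this

lemma Gf_congr (B C : Finset (Finset V)) (a : Finset V → ℝ) {ω η : V → Bool} (h : core B (supp ω) = core B (supp η)) :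
    Gf p B C a ω = Gf p B C a η := by
  have key : ∀ (ζ : V → Bool) W, xm (core B W) ζ = if core B W ⊆ core B (supp ζ) then 1 else 0 := by
    intro ζ W
    rw [xm_eq]
    congr 1
    rw [eq_iff_iff]
    constructor
    · intro h; rw [← core_core]; exact core_mono B h
    · intro h; exact h.trans (core_subset _ _)
  unfold Gf
  simp only [key, h]

lemma atom_harris (h0 : 0 ≤ p) (h1 : p ≤ 1) (f : (V → Bool) → ℝ) (hf0 : ∀ ω, 0 ≤ f ω) (hf : Monotone f)
    (B : Finset (Finset V)) (J0 : Finset V) :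
    Ex p (fun ω => if core B (supp ω) = J0 then f ω else 0) ≤
      Ex p (fun ω => if core B (supp ω) = J0 then 1 else 0) * Ex p (fun ω => f (up J0 ω)) := by
  by_cases hJ : core B J0 = J0
  swap
  · have : ∀ ω : V → Bool, core B (supp ω) ≠ J0 := by
      intro ω h; apply hJ; rw [← h, core_core]
    simp [this, Ex]
  have key : ∀ (F : (V → Bool) → ℝ), Ex p (fun ω => if core B (supp ω) = J0 then F ω else 0) =
     p ^ J0.card * Ex p (fun ω => if core B (supp (up J0 ω)) ⊆ J0 then F (up J0 ω) else 0) := by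
    intro F
    rw [← Ex_xm' (p := p) J0 (fun ω => if core B (supp ω) ⊆ J0 then F ω else 0)]
    congr 1; funext ω
    rw [xm_eq]
    by_cases h : core B (supp ω) = J0
    · have : J0 ⊆ supp ω := by rw [← h]; exact core_subset _ _
      simp [h, this]
    · rw [if_neg h]
      by_cases h2 : J0 ⊆ supp ω
      · have : J0 ⊆ core B (supp ω) := by rw [← hJ]; exact core_mono B h2
        rw [if_neg (fun h3 => h (Finset.Subset.antisymm h3 this))]; simp
      · simp [h2]
  rw [key f, key (fun _ => 1)]
  rw [mul_assoc]
  refine mul_le_mul_of_nonneg_left ?_ (by positivity)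
  have hh := harris h0 h1 (fun ω => f (up J0 ω)) (fun ω => if core B (supp (up J0 ω)) ⊆ J0 then 0 else 1) (fun ω => hf0 _)
    (fun ω => by split_ifs <;> simp) (hf.comp (up_mono J0)) (by
      intro ω η hle
      have hs := core_mono B (supp_mono (up_mono J0 hle))
      dsimp only
      split_ifs with h1 h2
      · simp
      · simp
      · exact absurd (hs.trans (by assumption)) h1
      · simp)
  have e1 : Ex p (fun ω => if core B (supp (up J0 ω)) ⊆ J0 then f (up J0 ω) else 0) =
     Ex p (fun ω => f (up J0 ω)) - Ex p (fun ω => f (up J0 ω) * (if core B (supp (up J0 ω)) ⊆ J0 then 0 else 1)) := by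
    rw [← Ex_sub]; congr 1; funext ω; split_ifs <;> simp
  have e2 : Ex p (fun ω => if core B (supp (up J0 ω)) ⊆ J0 then (1:ℝ) else 0) =
     1 - Ex p (fun ω => (if core B (supp (up J0 ω)) ⊆ J0 then (0:ℝ) else 1)) := by
    have := Ex_sub (p := p) (fun _ : V → Bool => (1:ℝ)) (fun ω => (if core B (supp (up J0 ω)) ⊆ J0 then (0:ℝ) else 1))
    rw [Ex_one] at this
    rw [← this]; congr 1; funext ω; split_ifs <;> norm_num
  rw [e1, e2]
  nlinarith

lemma atom_lower (h0 : 0 ≤ p) (h1 : p ≤ 1) (f G : (V → Bool) → ℝ) (hf01 : ∀ ω, f ω = 0 ∨ f ω = 1)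
    (D : (V → Bool) → Prop) [DecidablePred D] (hG : ∀ ω η, D ω → D η → G ω = G η) (δ : ℝ) (hδ : 0 < δ) (hδ1 : δ < 1)
    (hA : Ex p (fun ω => if D ω then f ω else 0) ≤ Ex p (fun ω => if D ω then 1 else 0) * (1 - δ)) :
    δ * Ex p (fun ω => if D ω then f ω else 0) ≤ Ex p (fun ω => if D ω then (f ω - G ω) ^ 2 else 0) := by
  have : ∃ γ, ∀ ω, D ω → G ω = γ := by
    by_cases h : ∃ ω, D ω
    · obtain ⟨η, hη⟩ := h; exact ⟨G η, fun ω hω => hG _ _ hω hη⟩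
    · exact ⟨0, fun ω hω => absurd ⟨ω, hω⟩ h⟩
  obtain ⟨γ, hγ⟩ := this
  have e : Ex p (fun ω => if D ω then (f ω - G ω) ^ 2 else 0) =
     (1 - 2 * γ) * Ex p (fun ω => if D ω then f ω else 0) + γ ^ 2 * Ex p (fun ω => if D ω then 1 else 0) := by
    rw [← Ex_const_mul, ← Ex_const_mul, ← Ex_add]
    congr 1; funext ω
    by_cases hD : D ω
    · simp only [hD, if_true, hγ ω hD]
      rcases hf01 ω with h | h <;> rw [h] <;> ring
    · simp [hD]
  rw [e]
  set A := Ex p (fun ω => if D ω then f ω else 0)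
  set P := Ex p (fun ω => if D ω then (1:ℝ) else 0)
  have hA0 : 0 ≤ A := Ex_nonneg h0 h1 fun ω => by
    split_ifs
    · rcases hf01 ω with h | h <;> rw [h] <;> simp
    · simp
  have h2 : 0 < 1 - δ := by linarith
  have h3 : (1 - δ) * (δ * A) ≤ (1 - δ) * ((1 - 2 * γ) * A + γ ^ 2 * P) := by
    nlinarith [mul_nonneg hA0 (sq_nonneg (γ - (1 - δ))), mul_nonneg (sq_nonneg γ) (sub_nonneg.2 hA)]
  exact le_of_mul_le_mul_left h3 h2

lemma E_J (h0 : 0 < p) (h1 : p < 1) (k : ℕ) (a : Finset V → ℝ) (ha : ∀ S, k < S.card → a S = 0) {c2 : ℝ} (hc2 : 0 < c2)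
    (hN : ∀ T, Nf (p / (1 - p)) a T ≤ 4 ^ T.card) :
    Ex p (fun ω => ((core (BB (p / (1 - p)) a c2) (supp ω)).card : ℝ)) ≤ k * (c2⁻¹ * 2 ^ k) := by
  have hr : 0 ≤ p / (1 - p) := div_nonneg h0.le (by linarith)
  set r := p / (1 - p) with hrd
  have hcard : ∀ T ∈ BB r a c2, T.card ≤ k := by
    intro T hT
    by_contra hcon
    push Not at hcon
    simp only [BB, Finset.mem_filter] at hT
    have : Nf r a T = 0 := by
      refine Finset.sum_eq_zero fun S _ => ?_
      split_ifs with h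
      · rw [ha S (lt_of_lt_of_le hcon (Finset.card_le_card h))]; simp
      · rfl
    linarith [hT.2.2]
  have hle : ∀ ω : V → Bool, ((core (BB r a c2) (supp ω)).card : ℝ) ≤ ∑ T ∈ BB r a c2, (k : ℝ) * xm T ω := by
    intro ω
    have h2 : (core (BB r a c2) (supp ω)).card ≤ ∑ T ∈ (BB r a c2).filter (· ⊆ supp ω), T.card := Finset.card_biUnion_le
    have h3 : ((core (BB r a c2) (supp ω)).card : ℝ) ≤ ∑ T ∈ (BB r a c2).filter (· ⊆ supp ω), (T.card : ℝ) := by exact_mod_cast h2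
    refine h3.trans ?_
    rw [Finset.sum_filter]
    refine Finset.sum_le_sum fun T hT => ?_
    rw [xm_eq]
    split_ifs
    · simpa using hcard T hT
    · simp
  refine (Ex_mono h0.le h1.le hle).trans ?_
  rw [Ex_sum]
  simp only [Ex_const_mul, Ex_xm_one]
  rw [← Finset.mul_sum]
  refine mul_le_mul_of_nonneg_left ?_ (by positivity)
  have h4 := sumB hr k a ha hc2 ∅ {∅} (BB r a c2) (fun T hT => ⟨hT, by simp⟩)
  simp only [Finset.sdiff_empty, Finset.sum_singleton] at h4
  have h5 : p ≤ r := by rw [hrd, le_div_iff₀ (by linarith)]; nlinarith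
  calc ∑ T ∈ BB r a c2, p ^ T.card ≤ ∑ T ∈ BB r a c2, r ^ T.card := Finset.sum_le_sum fun T _ => by gcongr
    _ ≤ _ := h4
    _ ≤ c2⁻¹ * 2 ^ k * 1 := by
      have := hN ∅
      simp at this
      gcongr
    _ = _ := by ring

lemma approx (h0 : 0 < p) (h1 : p ≤ 1/2) (k : ℕ) (f : (V → Bool) → ℝ) (a0 : Finset V → ℝ)
    (hf : ∀ ω, f ω = pol p a0 ω) (hd : ∀ i ω, dd f i ω = 0 ∨ dd f i ω = 1) (hb : ∀ ω, |f ω| ≤ 1)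
    (c c2 t : ℝ) (hc : 0 < c) (hc2 : 0 < c2) (ht : 0 < t) (hct : 2 * 64 ^ k * c ≤ t ^ 3) (τ : ℝ)
    (hτ : ∑ S : Finset V, (if S.card ≤ k then 0 else a0 S ^ 2 * (p / (1 - p)) ^ S.card) ≤ τ) :
    Ex p (fun ω => (f ω - Gf p (BB (p / (1 - p)) (trunc k a0) c2) (CC (BB (p / (1 - p)) (trunc k a0) c) k) (trunc k a0) ω) ^ 2) ≤
     3 * (τ + 2 * t * ((p / (1 - p)) * ∑ i, Ex p (dd f i)) + 8 ^ k * ((1 + 16 ^ k / c) ^ (k+1) * (c⁻¹ * 4 ^ k * c2))) := by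
  have hp1 : p < 1 := by linarith
  have hr : 0 ≤ p / (1 - p) := div_nonneg h0.le (by linarith)
  have hN : ∀ T, Nf (p / (1 - p)) (trunc k a0) T ≤ 4 ^ T.card := fun T => (Nf_trunc_le hr k a0 T).trans (Nf_bound h0 hp1 f a0 hf hb T)
  have k1 := kkl h0 h1 k f a0 hf c t hc ht hct hd
  have k2 := proj_bound h0.le hp1 k (trunc k a0) (trunc_zero k a0) hc hc2 hN
  set r := p / (1 - p) with hrd
  set a := trunc k a0 with had
  set B := BB r a c
  set g : (V → Bool) → ℝ := fun ω => ∑ S ∈ CC B k, a S * phi p S ω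
  set G := Gf p (BB r a c2) (CC B k) a
  have e1 : ∀ ω, f ω - G ω = pol p (fun S => if S.card ≤ k then 0 else a0 S) ω + pol p (fun S => if core B S = S then 0 else a S) ω + (g ω - G ω) := by
    intro ω
    have : f ω = pol p (fun S => if S.card ≤ k then 0 else a0 S) ω + pol p (fun S => if core B S = S then 0 else a S) ω + g ω := by
      rw [hf]
      simp only [g, CC, pol, Finset.sum_filter]
      rw [← Finset.sum_add_distrib, ← Finset.sum_add_distrib]
      refine Finset.sum_congr rfl fun S _ => ?_
      by_cases h1 : S.card ≤ k <;> by_cases h2 : core B S = S <;> simp [h1, h2, had, trunc]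
    rw [this]; ring
  have e2 : Ex p (fun ω => (f ω - G ω) ^ 2) ≤ Ex p (fun ω => 3 * (pol p (fun S => if S.card ≤ k then 0 else a0 S) ω ^ 2 +
      pol p (fun S => if core B S = S then 0 else a S) ω ^ 2 + (g ω - G ω) ^ 2)) := by
    refine Ex_mono h0.le hp1.le fun ω => ?_
    rw [e1]
    set x := pol p (fun S => if S.card ≤ k then 0 else a0 S) ω
    set y := pol p (fun S => if core B S = S then 0 else a S) ω
    set z := g ω - G ω
    nlinarith [sq_nonneg (x - y), sq_nonneg (y - z), sq_nonneg (x - z)]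
  refine e2.trans ?_
  rw [Ex_const_mul, Ex_add, Ex_add, parseval hp1, parseval hp1]
  have e3 : ∑ S : Finset V, (if S.card ≤ k then 0 else a0 S) ^ 2 * r ^ S.card ≤ τ := by
    refine le_trans (le_of_eq ?_) hτ
    refine Finset.sum_congr rfl fun S _ => by split_ifs <;> simp
  have e4 : ∑ S : Finset V, (if core B S = S then 0 else a S) ^ 2 * r ^ S.card ≤ 2 * t * (r * ∑ i, Ex p (dd f i)) := by
    refine le_trans (le_of_eq ?_) k1
    refine Finset.sum_congr rfl fun S _ => by split_ifs <;> simp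
  have e5 : Ex p (fun ω => (g ω - G ω) ^ 2) ≤ _ := k2
  linarith

lemma consts (k : ℕ) (hk : 2 ≤ k) : 8 ^ k * ((1 + 16 ^ k / ((2:ℝ)^(13*k))⁻¹) ^ (k+1) * ((((2:ℝ)^(13*k))⁻¹)⁻¹ * 4 ^ k * ((2:ℝ)^(40*k^2))⁻¹)) ≤ ((2:ℝ)^k)⁻¹ := by
  have h1 : 1 + 16 ^ k / ((2:ℝ)^(13*k))⁻¹ ≤ 2 ^ (18 * k) := by
    rw [div_inv_eq_mul, show (16:ℝ) = 2^4 by norm_num, ← pow_mul, ← pow_add]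
    have : (2:ℝ) ^ (18 * k) = 2 ^ (4 * k + 13 * k) * 2 ^ k := by rw [← pow_add]; congr 1; ring
    rw [this]
    have h2 : (1:ℝ) ≤ 2 ^ (4 * k + 13 * k) := one_le_pow₀ (by norm_num)
    have h3 : (2:ℝ) ^ 1 ≤ 2 ^ k := pow_le_pow_right₀ (by norm_num) (by omega)
    nlinarith
  calc _ ≤ 8 ^ k * (((2:ℝ) ^ (18 * k)) ^ (k+1) * ((((2:ℝ)^(13*k))⁻¹)⁻¹ * 4 ^ k * ((2:ℝ)^(40*k^2))⁻¹)) := by gcongr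
    _ = 2 ^ (3 * k + 18 * k * (k + 1) + 13 * k + 2 * k) * ((2:ℝ)^(40*k^2))⁻¹ := by
      rw [inv_inv, show (8:ℝ) = 2^3 by norm_num, show (4:ℝ) = 2^2 by norm_num]
      simp only [← pow_mul, pow_add]; ring
    _ ≤ ((2:ℝ)^k)⁻¹ := by
      rw [← div_eq_mul_inv, div_le_iff₀ (by positivity), inv_mul_eq_div, le_div_iff₀ (by positivity), ← pow_add]
      refine pow_le_pow_right₀ (by norm_num) ?_
      nlinarith

set_option maxHeartbeats 1000000 in
theorem thmH (h0 : 0 < p) (h1 : p ≤ 1/2) (f : (V → Bool) → ℝ) (hmono : Monotone f) (hf01 : ∀ ω, f ω = 0 ∨ f ω = 1)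
    (k : ℕ) (ε δ : ℝ) (hε : 0 < ε) (hδ : 0 < δ) (hδ1 : δ < 1) (hε1 : ε ≤ 1) (hEf : ε ≤ Ex p f)
    (hI : 2 * (p * (1 - p) * ∑ i, Ex p (dd f i)) ≤ k * (δ * ε) / 100) (hk : 1000 ≤ k * (δ * ε))
    (Bad : Finset V → Prop) (hBad : ∑ T ∈ Finset.univ.filter (fun T : Finset V => Bad T ∧ T.card ≤ 2 ^ (50 * k ^ 2)), p ^ T.card ≤ ε / 4) :
    ∃ T : Finset V, ¬ Bad T ∧ T.card ≤ 2 ^ (50 * k ^ 2) ∧ 1 - δ ≤ Ex p (fun ω => f (up T ω)) := by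
  by_contra hcon
  push Not at hcon
  have hp1 : p < 1 := by linarith
  have hde : δ * ε ≤ 1 := by nlinarith
  have hdep : 0 < δ * ε := by positivity
  have hk1000 : (1000:ℝ) ≤ k := by nlinarith
  have hkN : 1000 ≤ k := by exact_mod_cast hk1000
  obtain ⟨a0, hf⟩ := exists_pol hp1 f
  have hd : ∀ i ω, dd f i ω = 0 ∨ dd f i ω = 1 := by
    intro i ω
    have hle : f (Function.update ω i false) ≤ f (Function.update ω i true) := hmono (by
      intro j; by_cases h : j = i
      · subst h; simp
      · simp [h])
    unfold dd
    rcases hf01 (Function.update ω i false) with h2 | h2 <;> rcases hf01 (Function.update ω i true) with h3 | h3 <;>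
      rw [h2, h3] <;> rw [h2, h3] at hle <;> norm_num at *
  have hb : ∀ ω, |f ω| ≤ 1 := by intro ω; rcases hf01 ω with h | h <;> rw [h] <;> simp
  have hfnn : ∀ ω, 0 ≤ f ω := by intro ω; rcases hf01 ω with h | h <;> rw [h] <;> simp
  have hr : 0 ≤ p / (1 - p) := div_nonneg h0.le (by linarith)
  have hN : ∀ T, Nf (p / (1 - p)) (trunc k a0) T ≤ 4 ^ T.card := fun T => (Nf_trunc_le hr k a0 T).trans (Nf_bound h0 hp1 f a0 hf hb T)
  set Sd := ∑ i, Ex p (dd f i) with hSd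
  have hS0 : 0 ≤ Sd := Finset.sum_nonneg fun i _ => Ex_nonneg h0.le hp1.le fun ω => by rcases hd i ω with h | h <;> rw [h] <;> simp
  have htail : ∑ S : Finset V, (if S.card ≤ k then 0 else a0 S ^ 2 * (p / (1 - p)) ^ S.card) ≤ δ * ε / 200 := by
    have := tail_le h0 hp1 k f a0 hf hd
    have h2 : (k:ℝ) * ∑ S : Finset V, (if S.card ≤ k then 0 else a0 S ^ 2 * (p / (1 - p)) ^ S.card) ≤ k * (δ * ε / 200) := by
      linarith
    exact le_of_mul_le_mul_left h2 (by linarith)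
  set c : ℝ := ((2:ℝ)^(13*k))⁻¹ with hc
  set c2 : ℝ := ((2:ℝ)^(40*k^2))⁻¹ with hc2
  set t : ℝ := ((2:ℝ)^(2*k))⁻¹ with ht
  have hct : 2 * 64 ^ k * c ≤ t ^ 3 := by
    rw [hc, ht, inv_pow, ← pow_mul, show (64:ℝ) = 2^6 by norm_num, ← pow_mul, ← pow_succ', ← div_eq_mul_inv,
      div_le_iff₀ (by positivity), inv_mul_eq_div, le_div_iff₀ (by positivity), ← pow_add]
    refine pow_le_pow_right₀ (by norm_num) (by omega)
  have hap := approx h0 h1 k f a0 hf hd hb c c2 t (by positivity) (by positivity) (by positivity) hct _ htail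
  have h2k : ((2:ℝ)^k)⁻¹ ≤ δ * ε / 1000 := by
    have h3 : (k:ℝ) ≤ 2 ^ k := by exact_mod_cast (Nat.lt_two_pow_self).le
    rw [inv_le_comm₀ (by positivity) (by positivity)]
    rw [inv_div, div_le_iff₀ hdep]
    nlinarith
  have hR := (consts k (by omega)).trans h2k
  have hh : 2 * t * ((p / (1 - p)) * Sd) ≤ δ * ε / 100 := by
    have h3 : p / (1 - p) ≤ 4 * (p * (1 - p)) := by
      rw [div_le_iff₀ (by linarith)]; nlinarith [mul_nonneg h0.le (by nlinarith : 0 ≤ 4 * (1-p)^2 - 1)]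
    have h4 : t * k ≤ 1/4 := by
      rw [ht, inv_mul_eq_div, div_le_iff₀ (by positivity)]
      have h3 : (k:ℝ) ≤ 2 ^ k := by exact_mod_cast (Nat.lt_two_pow_self).le
      have h5 : (2:ℝ) ^ 2 ≤ 2 ^ k := pow_le_pow_right₀ (by norm_num) (by omega)
      rw [two_mul, pow_add]; nlinarith
    have h6 : (p / (1 - p)) * Sd ≤ 4 * (k * (δ * ε) / 200) := by
      calc _ ≤ 4 * (p * (1 - p)) * Sd := by gcongr
        _ ≤ _ := by linarith
    calc 2 * t * ((p / (1 - p)) * Sd) ≤ 2 * t * (4 * (k * (δ * ε) / 200)) := by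
          refine mul_le_mul_of_nonneg_left h6 (by positivity)
      _ = (t * k) * (δ * ε) * (8 / 200) := by ring
      _ ≤ (1/4) * (δ * ε) * (8/200) := by gcongr
      _ ≤ _ := by linarith
  set B := BB (p / (1 - p)) (trunc k a0) c2 with hBd
  set G := Gf p B (CC (BB (p / (1 - p)) (trunc k a0) c) k) (trunc k a0) with hGd
  have hup : Ex p (fun ω => (f ω - G ω) ^ 2) < δ * ε / 2 := by linarith
  obtain ⟨M, hM⟩ : ∃ M : ℕ, M = 2 ^ (50 * k ^ 2) := ⟨_, rfl⟩
  rw [← hM] at hBad hcon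
  have hMpos : (0:ℝ) < M := by rw [hM]; positivity
  clear_value c c2 t Sd
  -- lower bound
  have hlow : δ * Ex p (fun ω => if ¬ Bad (core B (supp ω)) ∧ (core B (supp ω)).card ≤ M then f ω else 0) ≤ Ex p (fun ω => (f ω - G ω) ^ 2) := by
    have e1 : Ex p (fun ω => (f ω - G ω) ^ 2) = ∑ J0 : Finset V, Ex p (fun ω => if core B (supp ω) = J0 then (f ω - G ω) ^ 2 else 0) := by
      rw [← Ex_sum]; congr 1; funext ω; simp
    have e2 : Ex p (fun ω => if ¬ Bad (core B (supp ω)) ∧ (core B (supp ω)).card ≤ M then f ω else 0) =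
       ∑ J0 : Finset V, if ¬ Bad J0 ∧ J0.card ≤ M then Ex p (fun ω => if core B (supp ω) = J0 then f ω else 0) else 0 := by
      have : ∀ J0 : Finset V, (if ¬ Bad J0 ∧ J0.card ≤ M then Ex p (fun ω => if core B (supp ω) = J0 then f ω else 0) else 0) =
         Ex p (fun ω => if core B (supp ω) = J0 then (if ¬ Bad J0 ∧ J0.card ≤ M then f ω else 0) else 0) := by
        intro J0; split_ifs with h
        · rfl
        · simp [Ex]
      simp only [this]
      rw [← Ex_sum]; congr 1; funext ω; simp
    rw [e1, e2, Finset.mul_sum]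
    refine Finset.sum_le_sum fun J0 _ => ?_
    split_ifs with h
    · refine atom_lower h0.le hp1.le f G hf01 (fun ω => core B (supp ω) = J0) (fun ω η h1 h2 => Gf_congr _ _ _ (h1.trans h2.symm)) δ hδ hδ1 ?_
      refine (atom_harris h0.le hp1.le f hfnn hmono B J0).trans ?_
      refine mul_le_mul_of_nonneg_left (hcon J0 h.1 h.2).le ?_
      exact Ex_nonneg h0.le hp1.le fun ω => by split_ifs <;> simp
    · rw [mul_zero]; exact Ex_nonneg h0.le hp1.le fun ω => by split_ifs <;> positivity
  have hMarkov : Ex p (fun ω => ((core B (supp ω)).card : ℝ)) / M ≤ ε / 4 := by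
    have h3 := E_J h0 hp1 k (trunc k a0) (trunc_zero k a0) (c2 := c2) (by rw [hc2]; positivity) hN
    rw [← hBd] at h3
    refine (div_le_div_of_nonneg_right h3 (by positivity)).trans ?_
    have h4 : (k:ℝ) * (c2⁻¹ * 2 ^ k) / M ≤ ((2:ℝ)^k)⁻¹ := by
      rw [hc2, inv_inv, div_le_iff₀ hMpos, ← div_eq_inv_mul, le_div_iff₀ (by positivity), hM]
      have h3 : (k:ℝ) ≤ 2 ^ k := by exact_mod_cast (Nat.lt_two_pow_self).le
      push_cast
      calc (k:ℝ) * (2 ^ (40 * k^2) * 2 ^ k) * 2 ^ k ≤ 2 ^ k * (2 ^ (40 * k^2) * 2 ^ k) * 2 ^ k := by gcongr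
        _ = 2 ^ (40 * k ^ 2 + 3 * k) := by rw [pow_add, mul_comm 3 k, pow_mul]; ring
        _ ≤ _ := pow_le_pow_right₀ (by norm_num) (by nlinarith)
    refine h4.trans (h2k.trans ?_)
    nlinarith
  have hsplit : ∀ ω : V → Bool, f ω ≤ (if ¬ Bad (core B (supp ω)) ∧ (core B (supp ω)).card ≤ M then f ω else 0) +
      (∑ T ∈ Finset.univ.filter (fun T : Finset V => Bad T ∧ T.card ≤ M), xm T ω + (M:ℝ)⁻¹ * ((core B (supp ω)).card : ℝ)) := by
    intro ω
    have hM0 := hMpos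
    have hs0 : 0 ≤ ∑ T ∈ Finset.univ.filter (fun T : Finset V => Bad T ∧ T.card ≤ M), xm T ω := Finset.sum_nonneg fun T _ => xm_nonneg T ω
    have hm0 : 0 ≤ (M:ℝ)⁻¹ * ((core B (supp ω)).card : ℝ) := by positivity
    have hf1 : f ω ≤ 1 := (abs_le.1 (hb ω)).2
    by_cases hc : (core B (supp ω)).card ≤ M
    · by_cases hBd' : Bad (core B (supp ω))
      · have : xm (core B (supp ω)) ω ≤ ∑ T ∈ Finset.univ.filter (fun T : Finset V => Bad T ∧ T.card ≤ M), xm T ω :=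
          Finset.single_le_sum (f := fun T => xm T ω) (fun T _ => xm_nonneg T ω) (Finset.mem_filter.2 ⟨Finset.mem_univ _, hBd', hc⟩)
        rw [xm_eq, if_pos (core_subset _ _)] at this
        simp only [hBd', not_true, false_and, if_false]
        linarith
      · simp only [hBd', hc, not_false_iff, true_and, if_true]; linarith
    · have : 1 ≤ (M:ℝ)⁻¹ * ((core B (supp ω)).card : ℝ) := by
        rw [inv_mul_eq_div, le_div_iff₀ hM0, one_mul]
        push Not at hc; exact_mod_cast hc.le
      simp only [hc, and_false, if_false]; linarith
  have hE := Ex_mono h0.le hp1.le hsplit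
  rw [Ex_add, Ex_add, Ex_sum, Ex_const_mul] at hE
  simp only [Ex_xm_one] at hE
  rw [inv_mul_eq_div] at hE
  have hfin : ε / 2 ≤ Ex p (fun ω => if ¬ Bad (core B (supp ω)) ∧ (core B (supp ω)).card ≤ M then f ω else 0) := by linarith
  nlinarith
end gen

section perc
variable {N : ℕ} {κ p : ℝ}

lemma bWeight_eq (p : ℝ) (ω : Cube N → Bool) : bWeight p ω = ∏ x, bw p (ω x) := by
  unfold bWeight bw
  rw [Finset.prod_ite, Finset.prod_const, Finset.prod_const]
  congr 3
  ext x; simp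

def Fe (κ : ℝ) (ω : Cube N → Bool) : ℝ := if ω ∈ emptyInter κ then 1 else 0

lemma Fe01 (ω : Cube N → Bool) : Fe κ ω = 0 ∨ Fe κ ω = 1 := by unfold Fe; split_ifs <;> simp

lemma mem_emptyInter (ω : Cube N → Bool) : ω ∈ emptyInter κ ↔ ∀ y, ∃ x, ω x = true ∧ cubeDot x y < κ * Real.sqrt N := by
  simp [emptyInter, halfCube, Set.eq_empty_iff_forall_notMem]

lemma Fe_mono : Monotone (Fe (N := N) κ) := by
  intro ω η h
  unfold Fe
  by_cases h1 : ω ∈ emptyInter κ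
  · have : η ∈ emptyInter κ := by
      rw [mem_emptyInter] at h1 ⊢
      intro y; obtain ⟨x, hx, hy⟩ := h1 y
      refine ⟨x, ?_, hy⟩
      have := h x; rw [hx] at this; exact top_le_iff.1 this
    simp [h1, this]
  · simp only [h1, if_false]; split_ifs <;> simp

lemma bernoulliP_eq (p : ℝ) (E : Set (Cube N → Bool)) : bernoulliP p E = Ex p (fun ω => if ω ∈ E then 1 else 0) := by
  unfold bernoulliP Ex
  refine Finset.sum_congr rfl fun ω _ => ?_
  rw [bWeight_eq]; by_cases h : ω ∈ E <;> simp [h]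

lemma boosting_iff (δ : ℝ) (T : Finset (Cube N)) : PerceptronBoosting κ p δ T ↔ 1 - δ ≤ Ex p (fun ω => Fe κ (up T ω)) := by
  unfold PerceptronBoosting
  rw [bernoulliP_eq, ge_iff_le]
  have hE : {ω : Cube N → Bool |
        ((⋂ x ∈ {x : Cube N | ω x = true}, halfCube κ x) ∩ ⋂ x ∈ T, halfCube κ x) =
          (∅ : Set (Cube N))} = {ω | up T ω ∈ emptyInter κ} := by
    ext ω
    rw [Set.mem_setOf_eq (p := fun ω => up T ω ∈ emptyInter κ), mem_emptyInter]
    simp only [Set.mem_setOf_eq, Set.eq_empty_iff_forall_notMem, Set.mem_inter_iff, Set.mem_iInter, halfCube, not_and_or, not_forall, ge_iff_le, not_le, up, Bool.or_eq_true, decide_eq_true_eq]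
    refine forall_congr' fun y => ?_
    constructor
    · rintro (⟨x, hx, h⟩ | ⟨x, hx, h⟩)
      · exact ⟨x, Or.inl hx, h⟩
      · exact ⟨x, Or.inr hx, h⟩
    · rintro ⟨x, hx | hx, h⟩
      · exact Or.inl ⟨x, hx, h⟩
      · exact Or.inr ⟨x, hx, h⟩
  rw [hE]
  have : (fun ω : Cube N → Bool => if ω ∈ {ω | up T ω ∈ emptyInter κ} then (1:ℝ) else 0) = fun ω => Fe κ (up T ω) := by
    funext ω; unfold Fe; by_cases h : up T ω ∈ emptyInter κ <;> simp [h]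
  rw [← this]

lemma influence_eq (p : ℝ) : influence (N := N) κ p = 2 * (p * (1 - p) * ∑ x, Ex p (dd (Fe (N := N) κ) x)) := by
  unfold influence
  rw [Finset.mul_sum, Finset.mul_sum]
  refine Finset.sum_congr rfl fun x _ => ?_
  have e1 : ∑ ω : Cube N → Bool, ∑ b : Bool, bWeight p ω * (if b then p else 1 - p) *
      (if (ω ∈ emptyInter κ ↔ Function.update ω x b ∈ emptyInter κ) then 0 else 1) =
      Ex p (fun ω => p * |Fe κ ω - Fe κ (Function.update ω x true)| + (1 - p) * |Fe κ ω - Fe κ (Function.update ω x false)|) := by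
    unfold Ex
    refine Finset.sum_congr rfl fun ω _ => ?_
    rw [bWeight_eq, Fintype.sum_bool]
    have : ∀ η : Cube N → Bool, (if (ω ∈ emptyInter κ ↔ η ∈ emptyInter κ) then (0:ℝ) else 1) = |Fe κ ω - Fe κ η| := by
      intro η; unfold Fe
      by_cases h1 : ω ∈ emptyInter κ <;> by_cases h2 : η ∈ emptyInter κ <;> simp [h1, h2]
    rw [this, this]; simp; ring
  rw [e1, Ex_resample x, ← Ex_const_mul, ← Ex_const_mul]
  congr 1; funext ω
  simp only [Function.update_idem, sub_self, abs_zero, mul_zero, zero_add, add_zero]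
  have hle : Fe κ (Function.update ω x false) ≤ Fe κ (Function.update ω x true) := Fe_mono (by
      intro j; by_cases h : j = x
      · subst h; simp
      · simp [h])
  rw [abs_sub_comm (Fe κ (Function.update ω x false)), abs_of_nonneg (by linarith)]
  unfold dd; ring

lemma influence_cont : Continuous (fun p : ℝ => influence (N := N) κ p) := by
  unfold influence bWeight
  refine continuous_finset_sum _ fun x _ => continuous_finset_sum _ fun ω _ => continuous_finset_sum _ fun b _ => ?_
  cases b <;> simp only [if_true, Bool.false_eq_true, if_false] <;> fun_prop

lemma pStar_spec (pN L : ℝ) (hL : L = Real.log (Real.log N) ^ ((1 : ℝ) / 10)) (hL0 : 0 ≤ L) (h1 : pN ≤ 1) :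
    pN ≤ pStar (N := N) κ pN ∧ pStar (N := N) κ pN ≤ 1 ∧ influence (N := N) κ (pStar (N := N) κ pN) ≤ 8 * L := by
  have hmem : (1:ℝ) ∈ {p : ℝ | pN ≤ p ∧ influence (N := N) κ p ≤ 8 * Real.log (Real.log N) ^ ((1 : ℝ) / 10)} := by
    refine ⟨h1, ?_⟩
    rw [influence_eq, ← hL]; simp [hL0]
  have hbdd : BddBelow {p : ℝ | pN ≤ p ∧ influence (N := N) κ p ≤ 8 * Real.log (Real.log N) ^ ((1 : ℝ) / 10)} :=
    ⟨pN, fun p hp => hp.1⟩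
  have hcl : IsClosed {p : ℝ | pN ≤ p ∧ influence (N := N) κ p ≤ 8 * Real.log (Real.log N) ^ ((1 : ℝ) / 10)} := by
    rw [Set.setOf_and]
    exact (isClosed_le continuous_const continuous_id).inter (isClosed_le influence_cont continuous_const)
  have h := hcl.csInf_mem ⟨1, hmem⟩ hbdd
  refine ⟨h.1, csInf_le hbdd hmem, ?_⟩
  rw [hL]; exact h.2

lemma Ex_mono_p {V : Type*} [Fintype V] [DecidableEq V] {p p' : ℝ} (h0 : 0 < p) (h1 : p < 1) (hpp : p ≤ p') (hp' : p' ≤ 1)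
    (f : (V → Bool) → ℝ) (hf0 : ∀ ω, 0 ≤ f ω) (hf : Monotone f) : Ex p f ≤ Ex p' f := by
  have hq : 0 < 1 - p := by linarith
  have hb0 : ∀ b, 0 < bw p b := by intro b; unfold bw; split_ifs <;> linarith
  have hb' : ∀ b, 0 ≤ bw p' b := by intro b; unfold bw; split_ifs <;> linarith
  have hh := harris h0.le h1.le f (fun ω => ∏ i, bw p' (ω i) / bw p (ω i)) hf0
    (fun ω => Finset.prod_nonneg fun i _ => div_nonneg (hb' _) (hb0 _).le) hf (by
      intro ω η hle
      refine Finset.prod_le_prod (fun i _ => div_nonneg (hb' _) (hb0 _).le) fun i _ => ?_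
      have := hle i
      revert this
      have hft : bw p' false / bw p false ≤ bw p' true / bw p true := by
        simp only [bw, Bool.false_eq_true, if_false, if_true]
        have a1 : (1 - p') / (1 - p) ≤ 1 := by rw [div_le_one hq]; linarith
        have a2 : 1 ≤ p' / p := by rw [one_le_div h0]; exact hpp
        linarith
      cases ω i <;> cases η i <;> simp [hft])
  have key : ∀ g : (V → Bool) → ℝ, Ex p (fun ω => g ω * ∏ i, bw p' (ω i) / bw p (ω i)) = Ex p' g := by
    intro g
    unfold Ex
    refine Finset.sum_congr rfl fun ω _ => ?_
    beta_reduce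
    rw [Finset.prod_div_distrib]
    have : ∏ i, bw p (ω i) ≠ 0 := Finset.prod_ne_zero_iff.2 fun i _ => (hb0 _).ne'
    field_simp
  rw [key f] at hh
  have h2 := key (fun _ => 1)
  simp only [one_mul] at h2
  rw [h2, Ex_one, mul_one] at hh
  exact hh

lemma cubeDot_neg (y : Cube N) : cubeDot (fun i => !(y i)) y = -N := by
  unfold cubeDot pmVal
  have : ∀ i, ((if (!(y i)) = true then (1:ℝ) else -1) * if y i = true then 1 else -1) = -1 := by
    intro i; cases y i <;> simp
  simp only [this]; simp

lemma full_mem (hN : κ ^ 2 < N) (ω : Cube N → Bool) (h : ∀ x, ω x = true) : ω ∈ emptyInter κ := by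
  rw [mem_emptyInter]
  intro y
  refine ⟨fun i => !(y i), h _, ?_⟩
  rw [cubeDot_neg]
  have h0 : (0:ℝ) < N := lt_of_le_of_lt (sq_nonneg κ) hN
  have h1 : |κ| < Real.sqrt N := by
    rw [← Real.sqrt_sq_eq_abs]; exact Real.sqrt_lt_sqrt (sq_nonneg _) hN
  have h2 : Real.sqrt N * Real.sqrt N = N := Real.mul_self_sqrt h0.le
  have h3 := (abs_lt.1 h1).1
  have h4 : 0 < Real.sqrt N := Real.sqrt_pos.2 h0
  nlinarith

lemma Ex_zero_eq {V : Type*} [Fintype V] [DecidableEq V] (f : (V → Bool) → ℝ) : Ex 0 f = f (fun _ => false) := by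
  unfold Ex
  rw [Finset.sum_eq_single (fun _ => false)]
  · simp [bw]
  · intro ω _ hω
    have : ∃ i, ω i = true := by
      by_contra h; push Not at h; apply hω; funext i; simpa using h i
    obtain ⟨i, hi⟩ := this
    rw [Finset.prod_eq_zero (Finset.mem_univ i) (by simp [hi, bw]), zero_mul]
  · simp

lemma Ex_one_eq {V : Type*} [Fintype V] [DecidableEq V] (f : (V → Bool) → ℝ) : Ex 1 f = f (fun _ => true) := by
  unfold Ex
  rw [Finset.sum_eq_single (fun _ => true)]
  · simp [bw]
  · intro ω _ hω
    have : ∃ i, ω i = false := by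
      by_contra h; push Not at h; apply hω; funext i; simpa using h i
    obtain ⟨i, hi⟩ := this
    rw [Finset.prod_eq_zero (Finset.mem_univ i) (by simp [hi, bw]), zero_mul]
  · simp

/-- summary of facts about p star -/
lemma pStar_facts (hN : κ ^ 2 < N) (pN εN L : ℝ) (hL : L = Real.log (Real.log N) ^ ((1 : ℝ) / 10)) (hL0 : 0 ≤ L)
    (h0 : 0 ≤ pN) (h1 : pN ≤ 1) (hε : 0 < εN) (hε1 : εN < 1) (hE : bernoulliP pN (emptyInter (N := N) κ) = εN) :
    0 < pStar (N := N) κ pN ∧ pStar (N := N) κ pN ≤ 1 ∧ εN ≤ Ex (pStar (N := N) κ pN) (Fe (N := N) κ) ∧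
     2 * (pStar (N := N) κ pN * (1 - pStar (N := N) κ pN) * ∑ x, Ex (pStar (N := N) κ pN) (dd (Fe (N := N) κ) x)) ≤ 8 * L := by
  obtain ⟨a1, a2, a3⟩ := pStar_spec (N := N) (κ := κ) pN L hL hL0 h1
  rw [influence_eq] at a3
  rw [bernoulliP_eq] at hE
  have hpos : pN ≠ 0 := by
    rintro rfl
    rw [Ex_zero_eq] at hE
    have : (fun _ => false : Cube N → Bool) ∉ emptyInter κ := by
      rw [mem_emptyInter]; push Not; exact ⟨fun _ => true, by simp⟩
    rw [if_neg this] at hE; linarith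
  have hlt : pN ≠ 1 := by
    rintro rfl
    rw [Ex_one_eq, if_pos (full_mem hN _ (by simp))] at hE
    linarith
  have hpos' : 0 < pN := lt_of_le_of_ne h0 (Ne.symm hpos)
  have hlt' : pN < 1 := lt_of_le_of_ne h1 hlt
  refine ⟨by linarith, a2, ?_, a3⟩
  rw [← hE]
  exact Ex_mono_p hpos' hlt' a1 a2 (Fe κ) (fun ω => by rcases Fe01 (κ := κ) ω with h | h <;> rw [h] <;> simp) Fe_mono
end perc

section perc
variable {N : ℕ} {κ p : ℝ}

def Ay (κ : ℝ) (y : Cube N) : Finset (Cube N) := Finset.univ.filter fun x => cubeDot x y < κ * Real.sqrt N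

lemma union_bd (h0 : 0 ≤ p) (h1 : p ≤ 1) : 1 - Ex p (Fe (N := N) κ) ≤ ∑ y : Cube N, (1 - p) ^ (Ay κ y).card := by
  have e1 : ∀ y : Cube N, (1 - p) ^ (Ay κ y).card = Ex p (fun ω : Cube N → Bool => ∏ x, (if x ∈ Ay κ y ∧ ω x = true then (0:ℝ) else 1)) := by
    intro y
    have := Ex_prod (p := p) (fun (x : Cube N) b => if x ∈ Ay κ y ∧ b = true then (0:ℝ) else 1)
    rw [this]
    have e2 : ∀ x, (p * (if x ∈ Ay κ y ∧ true = true then (0:ℝ) else 1) + (1 - p) * (if x ∈ Ay κ y ∧ false = true then (0:ℝ) else 1)) =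
       if x ∈ Ay κ y then 1 - p else 1 := by
      intro x; by_cases h : x ∈ Ay κ y <;> simp [h]
    rw [Finset.prod_congr rfl (fun x _ => e2 x)]
    simp [Finset.prod_ite_mem]
  simp only [e1]
  rw [← Ex_sum]
  have e3 : 1 - Ex p (Fe (N := N) κ) = Ex p (fun ω => 1 - Fe (N := N) κ ω) := by
    rw [Ex_sub, Ex_one]
  rw [e3]
  refine Ex_mono h0 h1 fun ω => ?_
  have hnn : ∀ y : Cube N, (0:ℝ) ≤ ∏ x, (if x ∈ Ay κ y ∧ ω x = true then (0:ℝ) else 1) := fun y =>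
    Finset.prod_nonneg fun x _ => by split_ifs <;> simp
  unfold Fe
  split_ifs with h
  · simp only [sub_self]; exact Finset.sum_nonneg fun y _ => hnn y
  · rw [mem_emptyInter] at h
    push Not at h
    obtain ⟨y, hy⟩ := h
    refine le_trans (le_of_eq ?_) (Finset.single_le_sum (f := fun y => ∏ x, (if x ∈ Ay κ y ∧ ω x = true then (0:ℝ) else 1)) (fun y _ => hnn y) (Finset.mem_univ y))
    rw [Finset.prod_eq_one, sub_zero]
    intro x _
    rw [if_neg]
    rintro ⟨h1, h2⟩
    simp only [Ay, Finset.mem_filter] at h1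
    linarith [hy x h2, h1.2]

lemma mgf (θ : ℝ) (y : Cube N) : ∑ x : Cube N, Real.exp (-θ * cubeDot x y) = (2 * Real.cosh θ) ^ N := by
  have e1 : ∀ x : Cube N, Real.exp (-θ * cubeDot x y) = ∏ i, Real.exp (-θ * (pmVal (x i) * pmVal (y i))) := by
    intro x; rw [← Real.exp_sum, cubeDot, Finset.mul_sum]
  simp only [e1]
  have := (Finset.prod_univ_sum (fun _ : Fin N => (Finset.univ : Finset Bool)) (fun i b => Real.exp (-θ * (pmVal b * pmVal (y i)))))
  rw [Fintype.piFinset_univ] at this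
  rw [← this]
  have e2 : ∀ i, ∑ b : Bool, Real.exp (-θ * (pmVal b * pmVal (y i))) = 2 * Real.cosh θ := by
    intro i
    rw [Fintype.sum_bool, Real.cosh_eq]
    cases y i <;> simp [pmVal] <;> ring
  rw [Finset.prod_congr rfl (fun i _ => e2 i)]; simp

lemma anti (K : ℝ) (hK : 0 ≤ K) (hκ : -K ≤ κ) (hN : (4 * K + 4) ^ 2 ≤ N) (y : Cube N) :
    Real.exp (-(2 * (4 * K + 4) ^ 2)) * 2 ^ N ≤ ((Ay κ y).card : ℝ) := by
  set s := 4 * K + 4 with hs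
  have hs4 : 4 ≤ s := by linarith
  have hNpos : (0:ℝ) < N := by nlinarith
  set R := Real.sqrt N with hR
  have hR0 : 0 < R := Real.sqrt_pos.2 hNpos
  have hRR : R ^ 2 = N := Real.sq_sqrt hNpos.le
  set θ := s / R with hθ
  have hθ0 : 0 < θ := by positivity
  have hθ2 : θ ^ 2 * N = s ^ 2 := by rw [hθ, div_pow, hRR]; field_simp
  have hθ1 : θ ^ 2 ≤ 1 := by
    have : θ ^ 2 * N ≤ 1 * N := by rw [hθ2]; linarith
    exact le_of_mul_le_mul_right this hNpos
  -- lower bound on the moment generating function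
  have hc1 : Real.exp (s ^ 2 / 4) ≤ Real.cosh θ ^ N := by
    have a1 : Real.exp (θ ^ 2 / 4) ≤ Real.cosh θ := by
      have b1 : 1 + θ ^ 2 / 2 ≤ Real.cosh θ := by
        rw [Real.cosh_eq]
        have := Real.quadratic_le_exp_of_nonneg hθ0.le
        have h2 : Real.cosh θ ^ 2 = Real.sinh θ ^ 2 + 1 := by linarith [Real.cosh_sq θ]
        have h3 : Real.cosh θ = 1 + 2 * Real.sinh (θ / 2) ^ 2 := by
          have := Real.cosh_two_mul (θ / 2)
          rw [Real.cosh_sq, mul_div_cancel₀ θ (by norm_num : (2:ℝ) ≠ 0)] at this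
          linarith
        have h4 : θ / 2 ≤ Real.sinh (θ / 2) := Real.self_le_sinh_iff.2 (by positivity)
        rw [← Real.cosh_eq, h3]
        nlinarith
      refine le_trans ?_ b1
      have b2 : 1 - θ ^ 2 / 4 ≤ Real.exp (-(θ ^ 2 / 4)) := by linarith [Real.add_one_le_exp (-(θ ^ 2 / 4))]
      have b3 : Real.exp (θ ^ 2 / 4) * Real.exp (-(θ ^ 2 / 4)) = 1 := by rw [← Real.exp_add]; simp
      have b4 := Real.exp_pos (θ ^ 2 / 4)
      have b5 : 0 ≤ θ ^ 2 := sq_nonneg _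
      have b6 : Real.exp (θ ^ 2 / 4) * (1 - θ ^ 2 / 4) ≤ 1 := by nlinarith
      have b7 : 1 ≤ (1 + θ ^ 2 / 2) * (1 - θ ^ 2 / 4) := by nlinarith
      have b8 : 0 < 1 - θ ^ 2 / 4 := by linarith
      exact le_of_mul_le_mul_right (b6.trans b7) b8
    calc Real.exp (s ^ 2 / 4) = Real.exp (θ ^ 2 / 4) ^ N := by rw [← Real.exp_nat_mul]; congr 1; rw [← hθ2]; ring
      _ ≤ _ := by gcongr
  have hc2 : Real.cosh (2 * θ) ^ N ≤ Real.exp (2 * s ^ 2) := by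
    calc Real.cosh (2 * θ) ^ N ≤ Real.exp ((2 * θ) ^ 2 / 2) ^ N := by
          gcongr
          exact Real.cosh_le_exp_half_sq _
      _ = _ := by rw [← Real.exp_nat_mul]; congr 1; rw [← hθ2]; ring
  have hm1 := mgf θ y
  have hm2 := mgf (2 * θ) y
  set A := Ay κ y with hA
  -- split
  have hsp : (2 * Real.cosh θ) ^ N ≤ 2 ^ N * Real.exp (s * K) + ∑ x ∈ A, Real.exp (-θ * cubeDot x y) := by
    rw [← hm1, ← Finset.sum_add_sum_compl A, add_comm]
    refine add_le_add ?_ le_rfl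
    have : ∀ x ∈ Aᶜ, Real.exp (-θ * cubeDot x y) ≤ Real.exp (s * K) := by
      intro x hx
      simp only [hA, Ay, Finset.mem_compl, Finset.mem_filter, Finset.mem_univ, true_and, not_lt] at hx
      refine Real.exp_le_exp.2 ?_
      have h5 : -(K * R) ≤ cubeDot x y := by
        refine le_trans ?_ hx
        rw [← neg_mul]; exact mul_le_mul_of_nonneg_right hκ hR0.le
      have h6 : θ * (K * R) = s * K := by rw [hθ]; field_simp
      nlinarith
    refine (Finset.sum_le_card_nsmul _ _ _ this).trans ?_
    rw [nsmul_eq_mul]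
    have h7 : ((Aᶜ).card : ℝ) ≤ 2 ^ N := by
      have := Finset.card_le_univ (Aᶜ)
      simp at this
      exact_mod_cast this
    gcongr
  have hcs := Finset.sum_mul_sq_le_sq_mul_sq A (fun _ => (1:ℝ)) (fun x => Real.exp (-θ * cubeDot x y))
  simp only [one_mul, one_pow, Finset.sum_const, nsmul_eq_mul, mul_one] at hcs
  have hsq : ∑ x ∈ A, Real.exp (-θ * cubeDot x y) ^ 2 ≤ 2 ^ N * Real.exp (2 * s ^ 2) := by
    have e : ∀ x, Real.exp (-θ * cubeDot x y) ^ 2 = Real.exp (-(2 * θ) * cubeDot x y) := by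
      intro x; rw [← Real.exp_nat_mul]; congr 1; push_cast; ring
    simp only [e]
    calc _ ≤ ∑ x : Cube N, Real.exp (-(2 * θ) * cubeDot x y) := Finset.sum_le_sum_of_subset_of_nonneg (Finset.subset_univ _) fun x _ _ => (Real.exp_pos _).le
      _ = _ := hm2
      _ ≤ _ := by rw [mul_pow]; gcongr
  have hlow : (2:ℝ) ^ N ≤ ∑ x ∈ A, Real.exp (-θ * cubeDot x y) := by
    rw [mul_pow] at hsp
    have h8 : Real.exp (s * K) + 1 ≤ Real.exp (s ^ 2 / 4) := by
      have : s ^ 2 / 4 = s * K + s := by rw [hs]; ring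
      rw [this, Real.exp_add]
      have h9 : 1 ≤ Real.exp (s * K) := Real.one_le_exp (by positivity)
      have h10 : s + 1 ≤ Real.exp s := Real.add_one_le_exp s
      nlinarith
    have h11 : (2:ℝ) ^ N * (Real.exp (s * K) + 1) ≤ 2 ^ N * Real.cosh θ ^ N := by
      refine mul_le_mul_of_nonneg_left (h8.trans hc1) (by positivity)
    linarith
  have hfin : (2:ℝ) ^ N * 2 ^ N ≤ (A.card : ℝ) * (2 ^ N * Real.exp (2 * s ^ 2)) := by
    calc (2:ℝ) ^ N * 2 ^ N ≤ (∑ x ∈ A, Real.exp (-θ * cubeDot x y)) ^ 2 := by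
          rw [sq]; gcongr
      _ ≤ _ := hcs
      _ ≤ _ := by gcongr
  have h12 : (2:ℝ) ^ N ≤ A.card * Real.exp (2 * s ^ 2) := by
    have : (2:ℝ) ^ N * 2 ^ N ≤ 2 ^ N * (A.card * Real.exp (2 * s ^ 2)) := by linarith
    exact le_of_mul_le_mul_left this (by positivity)
  rw [Real.exp_neg, inv_mul_eq_div, div_le_iff₀ (Real.exp_pos _)]
  exact h12

/-- For large `p` the event has probability close to one. -/
lemma large_p (κ : ℝ) : ∃ N0 : ℕ, ∀ N : ℕ, N0 ≤ N → ∀ p δ : ℝ, 0 ≤ p → p ≤ 1 → (N:ℝ) ^ 4 ≤ 2 ^ N * p → 1 / (N:ℝ) ≤ δ →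
    1 - δ ≤ Ex p (Fe (N := N) κ) := by
  set K := |κ|
  set η := Real.exp (-(2 * (4 * K + 4) ^ 2)) with hη
  have hη0 : 0 < η := Real.exp_pos _
  obtain ⟨N0, hN0⟩ := exists_nat_ge (max ((4 * K + 4) ^ 2) (2 / η))
  refine ⟨max N0 1, fun N hN p δ h0 h1 hp hδ => ?_⟩
  have hN1 : (1:ℝ) ≤ N := by exact_mod_cast (le_max_right _ _).trans hN
  have hNN : (N0:ℝ) ≤ N := by exact_mod_cast (le_max_left _ _).trans hN
  have hA : (4 * K + 4) ^ 2 ≤ N := (le_max_left _ _).trans (hN0.trans hNN)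
  have hB : 2 / η ≤ N := (le_max_right _ _).trans (hN0.trans hNN)
  rw [div_le_iff₀ hη0] at hB
  have hu := union_bd (N := N) (κ := κ) h0 h1
  have h3 : ∀ y : Cube N, (1 - p) ^ (Ay κ y).card ≤ Real.exp (-(2 * N)) := by
    intro y
    have h4 := anti (κ := κ) K (abs_nonneg _) (neg_abs_le κ) hA y
    rw [← hη] at h4
    calc (1 - p) ^ (Ay κ y).card ≤ Real.exp (-p) ^ (Ay κ y).card := by
          have hp1 : 0 ≤ 1 - p := by linarith
          gcongr
          linarith [Real.add_one_le_exp (-p)]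
      _ = Real.exp (-(p * (Ay κ y).card)) := by rw [← Real.exp_nat_mul]; congr 1; ring
      _ ≤ _ := by
        refine Real.exp_le_exp.2 (neg_le_neg ?_)
        calc 2 * (N:ℝ) ≤ N * η * N := by nlinarith
          _ ≤ η * N ^ 4 := by
            have : (N:ℝ)^2 ≤ N ^ 4 := pow_le_pow_right₀ hN1 (by norm_num)
            nlinarith
          _ ≤ η * (2 ^ N * p) := by gcongr
          _ = p * (η * 2 ^ N) := by ring
          _ ≤ _ := by gcongr
  have h5 := Finset.sum_le_card_nsmul Finset.univ _ _ (fun y _ => h3 y)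
  rw [nsmul_eq_mul] at h5
  have h6 : ((Finset.univ : Finset (Cube N)).card : ℝ) ≤ Real.exp N := by
    simp
    calc (2:ℝ) ^ N ≤ (Real.exp 1) ^ N := by
          gcongr
          linarith [Real.add_one_le_exp 1]
      _ = _ := by rw [← Real.exp_nat_mul]; simp
  have h7 : Real.exp N * Real.exp (-(2 * N)) ≤ 1 / N := by
    rw [← Real.exp_add, show (N:ℝ) + -(2 * N) = - N by ring, Real.exp_neg, one_div]
    refine inv_anti₀ (by linarith) ?_
    linarith [Real.add_one_le_exp (N:ℝ)]
  have h8 : ((Finset.univ : Finset (Cube N)).card : ℝ) * Real.exp (-(2 * N)) ≤ Real.exp N * Real.exp (-(2 * N)) :=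
    mul_le_mul_of_nonneg_right h6 (Real.exp_pos _).le
  linarith
end perc

section adm
variable {N : ℕ} {κ p : ℝ}

def gcell {m : ℕ} (a : Fin m → Bool) (z : Fin (m + 1) → Bool) : ℝ :=
  if ∀ i : Fin m, (z 0 == z i.succ) = a i then 1 else 0

lemma Ia_ncard {m : ℕ} (X : Fin (m + 1) → Cube N) (a : Fin m → Bool) :
    ((Ia X a).ncard : ℝ) = ∑ j, gcell a (fun i => X i j) := by
  unfold gcell
  rw [Finset.sum_boole]
  congr 1
  rw [← Set.ncard_coe_finset]
  congr 1
  ext j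
  simp [Ia, signSwitch]

lemma gcell_sum {m : ℕ} (a : Fin m → Bool) : ∑ z, gcell a z = 2 := by
  have key : (Finset.univ.filter fun z : Fin (m + 1) → Bool => ∀ i : Fin m, (z 0 == z i.succ) = a i)
      = {Fin.cons true a, Fin.cons false (fun i => !(a i))} := by
    ext z
    simp only [Finset.mem_filter, Finset.mem_univ, true_and, Finset.mem_insert, Finset.mem_singleton]
    constructor
    · intro h
      cases hz : z 0
      · right
        ext i
        refine Fin.cases ?_ (fun i => ?_) i
        · simp [hz]
        · have := h i
          rw [hz] at this
          simp only [Fin.cons_succ]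
          rw [← this]; cases z i.succ <;> rfl
      · left
        ext i
        refine Fin.cases ?_ (fun i => ?_) i
        · simp [hz]
        · have := h i
          rw [hz] at this
          simp only [Fin.cons_succ]
          rw [← this]; cases z i.succ <;> rfl
    · rintro (rfl | rfl) <;> intro i <;> simp
  unfold gcell
  rw [Finset.sum_boole, key, Finset.card_pair]
  · norm_num
  · intro h
    have := congrFun h 0
    simp at this

lemma exp_quad {t : ℝ} (ht : |t| ≤ 1) : Real.exp t - 1 ≤ t + t ^ 2 := by
  have := (abs_le.1 (Real.abs_exp_sub_one_sub_id_le ht)).2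
  linarith

lemma cell_mgf {m : ℕ} (a : Fin m → Bool) {t : ℝ} (ht : |t| ≤ 1) :
    ∑ X : Fin (m + 1) → Cube N, Real.exp (t * ((Ia X a).ncard : ℝ)) ≤
      (2 ^ N) ^ (m + 1) * Real.exp (N * ((2:ℝ)⁻¹ ^ m * (t + t ^ 2))) := by
  have e1 : ∀ X : Fin (m + 1) → Cube N, Real.exp (t * ((Ia X a).ncard : ℝ)) =
      ∏ j, Real.exp (t * gcell a (fun i => X i j)) := by
    intro X; rw [Ia_ncard, Finset.mul_sum, Real.exp_sum]
  simp only [e1]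
  have e2 : ∑ X : Fin (m + 1) → Cube N, ∏ j, Real.exp (t * gcell a (fun i => X i j)) =
      ∑ Z : Fin N → (Fin (m + 1) → Bool), ∏ j, Real.exp (t * gcell a (Z j)) := by
    exact Fintype.sum_equiv (Equiv.piComm (fun _ _ => Bool)) _ _ (fun X => rfl)
  rw [e2]
  have := (Finset.prod_univ_sum (fun _ : Fin N => (Finset.univ : Finset (Fin (m + 1) → Bool))) (fun _ z => Real.exp (t * gcell a z)))
  rw [Fintype.piFinset_univ] at this
  rw [← this, Finset.prod_const, Finset.card_univ, Fintype.card_fin]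
  have e3 : ∑ z, Real.exp (t * gcell a z) = 2 ^ (m + 1) + 2 * (Real.exp t - 1) := by
    have : ∀ z, Real.exp (t * gcell a z) = 1 + gcell a z * (Real.exp t - 1) := by
      intro z; unfold gcell; split_ifs <;> simp
    simp only [this]
    rw [Finset.sum_add_distrib, ← Finset.sum_mul, gcell_sum]
    simp
  rw [e3]
  have e4 : (2:ℝ) ^ (m + 1) + 2 * (Real.exp t - 1) ≤ 2 ^ (m + 1) * Real.exp ((2:ℝ)⁻¹ ^ m * (t + t ^ 2)) := by
    have h1 := Real.add_one_le_exp ((2:ℝ)⁻¹ ^ m * (t + t ^ 2))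
    have h2 := exp_quad ht
    have h3 : (2:ℝ) ^ (m + 1) * 2⁻¹ ^ m = 2 := by
      rw [pow_succ, mul_right_comm, ← mul_pow]; norm_num
    calc (2:ℝ) ^ (m + 1) + 2 * (Real.exp t - 1) ≤ 2 ^ (m + 1) + 2 * (t + t ^ 2) := by linarith
      _ = 2 ^ (m + 1) * ((2:ℝ)⁻¹ ^ m * (t + t ^ 2) + 1) := by linear_combination (-(t + t ^ 2)) * h3
      _ ≤ _ := by gcongr
  have e5 : (0:ℝ) ≤ 2 ^ (m + 1) + 2 * (Real.exp t - 1) := by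
    rw [← e3]; exact Finset.sum_nonneg fun z _ => (Real.exp_pos _).le
  calc _ ≤ ((2:ℝ) ^ (m + 1) * Real.exp ((2:ℝ)⁻¹ ^ m * (t + t ^ 2))) ^ N := pow_le_pow_left₀ e5 e4 N
    _ = _ := by
      rw [mul_pow, ← Real.exp_nat_mul, ← pow_mul, ← pow_mul, mul_comm N (m + 1)]

lemma cell_tail {m : ℕ} (a : Fin m → Bool) {t D : ℝ} (ht : |t| ≤ 1) :
    ((Finset.univ.filter fun X : Fin (m + 1) → Cube N =>
      |t| * D < t * (((Ia X a).ncard : ℝ) - (2:ℝ)⁻¹ ^ m * N)).card : ℝ) ≤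
      (2 ^ N) ^ (m + 1) * Real.exp (N * ((2:ℝ)⁻¹ ^ m * t ^ 2) - |t| * D) := by
  have h := cell_mgf (N := N) a ht
  set S := (Finset.univ.filter fun X : Fin (m + 1) → Cube N =>
      |t| * D < t * (((Ia X a).ncard : ℝ) - (2:ℝ)⁻¹ ^ m * N)) with hS
  set q := (2:ℝ)⁻¹ ^ m
  have h1 : (S.card : ℝ) * Real.exp (|t| * D + t * (q * N)) ≤ ∑ X : Fin (m + 1) → Cube N, Real.exp (t * ((Ia X a).ncard : ℝ)) := by
    rw [← nsmul_eq_mul]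
    refine (Finset.card_nsmul_le_sum S (fun X => Real.exp (t * ((Ia X a).ncard : ℝ))) _ ?_).trans
      (Finset.sum_le_sum_of_subset_of_nonneg (Finset.subset_univ _) fun x _ _ => (Real.exp_pos _).le)
    intro X hX
    rw [hS, Finset.mem_filter] at hX
    exact Real.exp_le_exp.2 (by linarith [hX.2])
  have h2 := h1.trans h
  have h3 : Real.exp (N * (q * (t + t ^ 2))) = Real.exp (N * (q * t ^ 2) - |t| * D) * Real.exp (|t| * D + t * (q * N)) := by
    rw [← Real.exp_add]; congr 1; ring
  rw [h3, ← mul_assoc ((2 ^ N) ^ (m + 1) : ℝ)] at h2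
  exact le_of_mul_le_mul_right h2 (Real.exp_pos _)

lemma nonadm_card (m : ℕ) (hN : 2 ≤ N) (hm : ((m:ℝ) + 1) ^ 2 * Real.log N ≤ N) :
    ((Finset.univ.filter fun X : Fin (m + 1) → Cube N => ¬ Admissible 10 X).card : ℝ) ≤
      (2 ^ N * 2 / (N:ℝ) ^ 9) ^ (m + 1) := by
  have hN2 : (2:ℝ) ≤ N := by exact_mod_cast hN
  have hN0 : (0:ℝ) < N := by linarith
  have hl : 0 < Real.log N := Real.log_pos (by linarith)
  set l := Real.log N with hldef
  set t := ((m:ℝ) + 1) * Real.sqrt (l / N) with ht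
  have ht0 : 0 < t := by positivity
  have ht2 : t ^ 2 * N = ((m:ℝ) + 1) ^ 2 * l := by
    rw [ht, mul_pow, Real.sq_sqrt (by positivity)]; field_simp
  have ht1 : t ≤ 1 := by
    have : t ^ 2 * N ≤ 1 * N := by rw [ht2]; linarith
    have := le_of_mul_le_mul_right this hN0
    nlinarith
  have htD : t * (10 * Real.sqrt (N * l)) = 10 * (m + 1) * l := by
    have : Real.sqrt (l / N) * Real.sqrt (N * l) = l := by
      rw [← Real.sqrt_mul (by positivity), show l / N * (N * l) = l ^ 2 by field_simp, Real.sqrt_sq hl.le]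
    calc t * (10 * Real.sqrt (N * l)) = 10 * (m + 1) * (Real.sqrt (l / N) * Real.sqrt (N * l)) := by rw [ht]; ring
      _ = _ := by rw [this]
  set D := 10 * Real.sqrt (N * l) with hD
  have hq : ((m:ℝ) + 1) * (2:ℝ)⁻¹ ^ m ≤ 1 := by
    have : (m:ℝ) + 1 ≤ 2 ^ m := by exact_mod_cast Nat.lt_two_pow_self
    rw [inv_pow, ← div_eq_mul_inv, div_le_one (by positivity)]; exact this
  set B : ℝ := (2 ^ N) ^ (m + 1) * (1 / (N:ℝ) ^ 9) ^ (m + 1) with hB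
  have hexp : ∀ s : ℝ, |s| = t → (2 ^ N) ^ (m + 1) * Real.exp (N * ((2:ℝ)⁻¹ ^ m * s ^ 2) - |s| * D) ≤ B := by
    intro s hs
    rw [← sq_abs s, hs, htD, hB]
    have h1 : (N:ℝ) * ((2:ℝ)⁻¹ ^ m * t ^ 2) ≤ (m + 1) * l := by
      calc (N:ℝ) * ((2:ℝ)⁻¹ ^ m * t ^ 2) = (((m:ℝ) + 1) * (2:ℝ)⁻¹ ^ m) * ((m + 1) * l) := by
            linear_combination ((2:ℝ)⁻¹ ^ m) * ht2
        _ ≤ 1 * ((m + 1) * l) := by gcongr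
        _ = _ := one_mul _
    have h2 : Real.exp (-(((m + 1 : ℕ)) * (((9:ℕ):ℝ) * l))) = (1 / (N:ℝ) ^ 9) ^ (m + 1) := by
      rw [Real.exp_neg, Real.exp_nat_mul, Real.exp_nat_mul, hldef, Real.exp_log hN0, one_div, inv_pow]
    rw [← h2]
    refine mul_le_mul_of_nonneg_left (Real.exp_le_exp.2 ?_) (by positivity)
    push_cast
    linarith
  have hsub : (Finset.univ.filter fun X : Fin (m + 1) → Cube N => ¬ Admissible 10 X) ⊆
      Finset.univ.biUnion (fun a : Fin m → Bool =>
        (Finset.univ.filter fun X : Fin (m + 1) → Cube N => |t| * D < t * (((Ia X a).ncard : ℝ) - (2:ℝ)⁻¹ ^ m * N)) ∪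
        (Finset.univ.filter fun X : Fin (m + 1) → Cube N => |-t| * D < -t * (((Ia X a).ncard : ℝ) - (2:ℝ)⁻¹ ^ m * N))) := by
    intro X hX
    simp only [Finset.mem_filter, Finset.mem_univ, true_and, Admissible, not_forall, not_le] at hX
    obtain ⟨a, ha⟩ := hX
    simp only [Finset.mem_biUnion, Finset.mem_union, Finset.mem_filter, Finset.mem_univ, true_and]
    refine ⟨a, ?_⟩
    rw [abs_neg, abs_of_pos ht0]
    have e : (2:ℝ) ^ (-(m:ℝ)) = 2⁻¹ ^ m := by
      rw [Real.rpow_neg (by norm_num), Real.rpow_natCast, inv_pow]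
    rw [e] at ha
    rcases lt_abs.1 ha with h | h
    · left; exact mul_lt_mul_of_pos_left h ht0
    · right
      rw [neg_mul, ← mul_neg]
      exact mul_lt_mul_of_pos_left h ht0
  have hc : ((Finset.univ.filter fun X : Fin (m + 1) → Cube N => ¬ Admissible 10 X).card : ℝ) ≤ ∑ a : Fin m → Bool, (B + B) := by
    refine le_trans (Nat.cast_le.2 ((Finset.card_le_card hsub).trans Finset.card_biUnion_le)) ?_
    rw [Nat.cast_sum]
    refine Finset.sum_le_sum fun a _ => ?_
    refine le_trans (Nat.cast_le.2 (Finset.card_union_le _ _)) ?_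
    rw [Nat.cast_add]
    refine add_le_add ((cell_tail a ?_).trans (hexp t (abs_of_pos ht0))) ((cell_tail a ?_).trans (hexp (-t) ?_))
    · rw [abs_of_pos ht0]; exact ht1
    · rw [abs_neg, abs_of_pos ht0]; exact ht1
    · rw [abs_neg, abs_of_pos ht0]
  refine hc.trans (le_of_eq ?_)
  rw [Finset.sum_const, nsmul_eq_mul, hB]
  simp only [Finset.card_univ, Fintype.card_fun, Fintype.card_bool, Fintype.card_fin]
  rw [show (2:ℝ) ^ N * 2 / (N:ℝ) ^ 9 = 2 ^ N * 2 * (1 / (N:ℝ) ^ 9) by ring, mul_pow, mul_pow]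
  push_cast
  ring

def BadT (T : Finset (Cube N)) : Prop :=
  T.Nonempty ∧ ¬ ∃ m : ℕ, ∃ X : Fin (m + 1) → Cube N, m + 1 = T.card ∧ Finset.image X Finset.univ = T ∧ Admissible 10 X

lemma bad_sum (M : ℕ) (hN : 2 ≤ N) (hM : (M:ℝ) ^ 2 * Real.log N ≤ N) (h0 : 0 ≤ p) (hp : 2 ^ N * p ≤ (N:ℝ) ^ 4) :
    ∑ T ∈ Finset.univ.filter (fun T : Finset (Cube N) => BadT T ∧ T.card ≤ M), p ^ T.card ≤ (M + 1) * (2 / (N:ℝ) ^ 5) := by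
  have hN2 : (2:ℝ) ≤ N := by exact_mod_cast hN
  have hN0 : (0:ℝ) < N := by linarith
  have hl : 0 < Real.log N := Real.log_pos (by linarith)
  rw [← Finset.sum_fiberwise_of_maps_to (s := Finset.univ.filter (fun T : Finset (Cube N) => BadT T ∧ T.card ≤ M))
    (t := Finset.range (M + 1)) (g := fun T => T.card)
    (fun T hT => by simp only [Finset.mem_filter] at hT; exact Finset.mem_range.2 (by omega))]
  have hx1 : 2 / (N:ℝ) ^ 5 ≤ 1 := by
    rw [div_le_one (by positivity)]
    calc (2:ℝ) ≤ N := hN2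
      _ ≤ N ^ 5 := le_self_pow₀ (by linarith) (by norm_num)
  have : ∀ n ∈ Finset.range (M + 1), ∑ T ∈ (Finset.univ.filter (fun T : Finset (Cube N) => BadT T ∧ T.card ≤ M)).filter (fun T => T.card = n), p ^ T.card ≤ 2 / (N:ℝ) ^ 5 := by
    intro n hn
    rw [Finset.mem_range] at hn
    rw [Finset.sum_congr rfl (g := fun _ => p ^ n) (fun T hT => by rw [(Finset.mem_filter.1 hT).2]), Finset.sum_const, nsmul_eq_mul]
    rcases n with _ | m
    · have : (Finset.univ.filter (fun T : Finset (Cube N) => BadT T ∧ T.card ≤ M)).filter (fun T => T.card = 0) = ∅ := by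
        ext T
        simp only [Finset.mem_filter, Finset.mem_univ, true_and, Finset.notMem_empty, iff_false]
        rintro ⟨⟨⟨h, _⟩, _⟩, h2⟩
        exact h.card_pos.ne' h2
      rw [this]; simp; positivity
    · have hsurj : Set.SurjOn (fun X : Fin (m + 1) → Cube N => Finset.image X Finset.univ)
        ((Finset.univ.filter fun X : Fin (m + 1) → Cube N => ¬ Admissible 10 X) : Finset _)
        (((Finset.univ.filter (fun T : Finset (Cube N) => BadT T ∧ T.card ≤ M)).filter (fun T => T.card = m + 1) : Finset _) : Set (Finset (Cube N))) := by
        intro T hT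
        simp only [Finset.coe_filter, Finset.mem_filter, Finset.mem_univ, true_and, Set.mem_setOf_eq] at hT
        obtain ⟨⟨hb, _⟩, hc⟩ := hT
        set e := (T.equivFinOfCardEq hc).symm
        have him : Finset.image (fun i => (e i : Cube N)) Finset.univ = T := by
          ext x
          simp only [Finset.mem_image, Finset.mem_univ, true_and]
          constructor
          · rintro ⟨i, rfl⟩; exact (e i).2
          · intro hx; exact ⟨e.symm ⟨x, hx⟩, by simp⟩
        refine ⟨fun i => (e i : Cube N), ?_, him⟩
        simp only [Finset.coe_filter, Finset.mem_univ, true_and, Set.mem_setOf_eq]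
        intro hA
        exact hb.2 ⟨m, _, hc.symm, him, hA⟩
      have h1 := Finset.card_le_card_of_surjOn _ hsurj
      have h2 := nonadm_card (N := N) m hN (by
        refine le_trans ?_ hM
        have : (m:ℝ) + 1 ≤ M := by exact_mod_cast (by omega : m + 1 ≤ M)
        gcongr)
      calc _ ≤ (2 ^ N * 2 / (N:ℝ) ^ 9) ^ (m + 1) * p ^ (m + 1) := by
            refine mul_le_mul_of_nonneg_right (le_trans (Nat.cast_le.2 h1) h2) (by positivity)
        _ = (2 * (2 ^ N * p) / (N:ℝ) ^ 9) ^ (m + 1) := by rw [← mul_pow]; congr 1; ring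
        _ ≤ (2 / (N:ℝ) ^ 5) ^ (m + 1) := by
            refine pow_le_pow_left₀ (by positivity) ?_ _
            calc 2 * (2 ^ N * p) / (N:ℝ) ^ 9 ≤ 2 * (N:ℝ) ^ 4 / N ^ 9 := by gcongr
              _ = _ := by field_simp
        _ ≤ _ := by
            rw [pow_succ]
            exact mul_le_of_le_one_left (by positivity) (pow_le_one₀ (by positivity) hx1)
  refine (Finset.sum_le_sum this).trans (le_of_eq ?_)
  rw [Finset.sum_const, nsmul_eq_mul, Finset.card_range]
  push_cast; ring
end adm

section fin
variable {N : ℕ} {κ p : ℝ}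

def S0 (N : ℕ) : Finset (Cube N) := insert (fun _ => true) (Finset.univ.image fun (j : Fin N) (i : Fin N) => decide (i = j))

lemma S0_card : (S0 N).card ≤ N + 1 := by
  unfold S0
  refine (Finset.card_insert_le _ _).trans (Nat.succ_le_succ ?_)
  exact Finset.card_image_le.trans (by simp)

lemma S0_card' : N ≤ (S0 N).card := by
  unfold S0
  refine le_trans ?_ (Finset.card_le_card (Finset.subset_insert _ _))
  rw [Finset.card_image_of_injective]
  · simp
  · intro j j' h
    have := congrFun h j
    simpa using this

lemma exists_enum {T : Finset (Cube N)} {m : ℕ} (hc : T.card = m + 1) :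
    ∃ X : Fin (m + 1) → Cube N, Finset.image X Finset.univ = T := by
  set e := (T.equivFinOfCardEq hc).symm
  refine ⟨fun i => (e i : Cube N), ?_⟩
  ext x
  simp only [Finset.mem_image, Finset.mem_univ, true_and]
  constructor
  · rintro ⟨i, rfl⟩; exact (e i).2
  · intro hx; exact ⟨e.symm ⟨x, hx⟩, by simp⟩

lemma pad_good (hN : 3 ≤ N) {T : Finset (Cube N)} (hT : S0 N ⊆ T) : ¬ BadT T := by
  rintro ⟨hne, hb⟩
  obtain ⟨m, hm⟩ : ∃ m, T.card = m + 1 := ⟨T.card - 1, by have := hne.card_pos; omega⟩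
  obtain ⟨X, hX⟩ := exists_enum hm
  refine hb ⟨m, X, hm.symm, hX, ?_⟩
  have hNm : N ≤ m + 1 := by
    rw [← hm]; exact S0_card'.trans (Finset.card_le_card hT)
  have hN3 : (3:ℝ) ≤ N := by exact_mod_cast hN
  have hl : 1 ≤ Real.log N := by
    rw [Real.le_log_iff_exp_le (by linarith)]
    linarith [Real.exp_one_lt_d9]
  have hD : 1 ≤ 10 * Real.sqrt (N * Real.log N) := by
    have : 1 ≤ Real.sqrt (N * Real.log N) := Real.one_le_sqrt.2 (by nlinarith)
    linarith
  intro a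
  refine le_trans ?_ hD
  have h1 : (Ia X a).ncard ≤ 1 := by
    rw [Set.ncard_le_one_iff]
    intro j j' hj hj'
    simp only [Ia, signSwitch, Set.mem_setOf_eq] at hj hj'
    have h2 : ∀ i, (X 0 j == X i j) = (X 0 j' == X i j') := by
      intro i
      refine Fin.cases ?_ (fun i => ?_) i
      · simp
      · rw [hj i, hj' i]
    have hmem : ∀ x ∈ S0 N, (X 0 j == x j) = (X 0 j' == x j') := by
      intro x hx
      have := hT hx
      rw [← hX] at this
      obtain ⟨i, _, rfl⟩ := Finset.mem_image.1 this
      exact h2 i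
    have h3 : X 0 j = X 0 j' := by simpa using hmem (fun _ => true) (Finset.mem_insert_self _ _)
    have h4 := hmem (fun i => decide (i = j)) (Finset.mem_insert_of_mem (Finset.mem_image_of_mem _ (Finset.mem_univ j)))
    rw [h3] at h4
    simp only [decide_true] at h4
    by_contra hne
    rw [decide_eq_false (fun h => hne h.symm)] at h4
    cases h5 : X 0 j' <;> rw [h5] at h4 <;> simp at h4
  have h6 : (2:ℝ) ^ (-(m:ℝ)) * N ≤ 1 := by
    rw [Real.rpow_neg (by norm_num), Real.rpow_natCast, inv_mul_le_iff₀ (by positivity), mul_one]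
    have : (m:ℝ) + 1 ≤ 2 ^ m := by exact_mod_cast Nat.lt_two_pow_self
    have : (N:ℝ) ≤ m + 1 := by exact_mod_cast hNm
    linarith
  have h7 : 0 ≤ (2:ℝ) ^ (-(m:ℝ)) * N := by positivity
  have h8 : ((Ia X a).ncard : ℝ) ≤ 1 := by exact_mod_cast h1
  have h9 : (0:ℝ) ≤ ((Ia X a).ncard : ℝ) := by positivity
  rw [abs_le]; constructor <;> linarith

lemma single_good (x : Cube N) : ¬ BadT ({x} : Finset (Cube N)) := by
  rintro ⟨hne, hb⟩
  refine hb ⟨0, fun _ => x, by simp, by simp, ?_⟩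
  intro a
  have : Ia (fun _ : Fin (0 + 1) => x) a = Set.univ := by
    ext j; simp [Ia]
  rw [this]
  simp [Set.ncard_univ]
  positivity

lemma finish {δ A : ℝ} (T : Finset (Cube N)) (hne : T.Nonempty) (hT : ¬ BadT T)
    (hb : 1 - δ ≤ Ex p (fun ω => Fe κ (up T ω))) (hA : (T.card : ℝ) ≤ A) :
    ∃ m : ℕ, ∃ X : Fin (m + 1) → Cube N, Admissible 10 X ∧
      PerceptronBoosting κ p δ (Finset.image X Finset.univ) ∧ ((m : ℝ) + 1) ≤ A := by
  unfold BadT at hT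
  push Not at hT
  obtain ⟨m, X, h1, h2, h3⟩ := hT hne
  refine ⟨m, X, h3, ?_, ?_⟩
  · rw [h2, boosting_iff]; exact hb
  · have : (m:ℝ) + 1 = T.card := by exact_mod_cast h1
    rw [this]; exact hA

lemma boost_mono (h0 : 0 ≤ p) (h1 : p ≤ 1) {S T : Finset (Cube N)} (h : S ⊆ T) :
    Ex p (fun ω => Fe κ (up S ω)) ≤ Ex p (fun ω => Fe κ (up T ω)) :=
  Ex_mono h0 h1 fun ω => Fe_mono (up_mono_left h ω)

lemma pow4 (n : ℕ) (h : 20 ≤ n) : 2 * n ^ 4 ≤ 2 ^ n := by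
  induction n, h using Nat.le_induction with
  | base => norm_num
  | succ n hn ih =>
    have : (n + 1) ^ 4 ≤ 2 * n ^ 4 := by
      have h1 : 20 * n ^ 3 ≤ n ^ 4 := by rw [pow_succ n 3, mul_comm]; exact Nat.mul_le_mul_left _ hn
      have h2 : n ^ 2 ≤ n ^ 3 := Nat.pow_le_pow_right (by omega) (by norm_num)
      have h3 : n ≤ n ^ 3 := Nat.le_self_pow (by norm_num) n
      have h4 : 1 ≤ n ^ 3 := Nat.one_le_pow _ _ (by omega)
      nlinarith
    rw [pow_succ 2 n]
    omega

lemma num1 {n M : ℝ} (hn : 20 ≤ n) (hM : M ≤ n) : (M + 1) * (2 / n ^ 5) ≤ 1 / n / 4 := by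
  have hn0 : 0 < n := by linarith
  have h2 : 20 * n ^ 2 ≤ n ^ 5 := by
    have h3 : (20:ℝ) ^ 3 ≤ n ^ 3 := by gcongr
    have h4 : (0:ℝ) ≤ n ^ 2 := sq_nonneg n
    have h5 : n ^ 5 = n ^ 3 * n ^ 2 := by ring
    rw [h5]; exact mul_le_mul_of_nonneg_right (by linarith) h4
  have h6 : (M + 1) * 2 * (n * 4) ≤ n ^ 5 := by
    have : (M + 1) * 2 * (n * 4) ≤ (n + 1) * 2 * (n * 4) := by gcongr
    nlinarith
  calc (M + 1) * (2 / n ^ 5) = ((M + 1) * 2 * (n * 4)) / (n ^ 5 * (n * 4)) := by field_simp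
    _ ≤ n ^ 5 / (n ^ 5 * (n * 4)) := by gcongr
    _ = _ := by field_simp

set_option maxHeartbeats 1000000 in
lemma core_exists (κ : ℝ) : ∃ N₀ : ℕ, ∀ N : ℕ, N₀ ≤ N → ∀ p δ ε L : ℝ, 1 ≤ L → 0 < ε → ε < 1 → 0 < δ → δ < 1 →
    0 < p → p ≤ 1 → ε ≤ Ex p (Fe (N := N) κ) → 2 * (p * (1 - p) * ∑ x, Ex p (dd (Fe (N := N) κ) x)) ≤ 8 * L →
    ∃ m : ℕ, ∃ X : Fin (m + 1) → Cube N, Admissible 10 X ∧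
      PerceptronBoosting κ p δ (Finset.image X Finset.univ) ∧ ((m : ℝ) + 1) ≤ Real.exp (10 ^ 15 * (L / (δ * ε)) ^ 2) := by
  obtain ⟨N1, hN1⟩ := large_p κ
  obtain ⟨N2, hN2⟩ := exists_nat_gt (κ ^ 2)
  refine ⟨max N1 (max N2 20), fun N hN p δ ε L hL hε hε1 hδ hδ1 hp hp1 hEf hI => ?_⟩
  have hNa : N1 ≤ N := (le_max_left _ _).trans hN
  have hNb : κ ^ 2 < N := lt_of_lt_of_le hN2 (by exact_mod_cast ((le_max_left _ _).trans (le_max_right _ _)).trans hN)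
  have hNc : 20 ≤ N := ((le_max_right _ _).trans (le_max_right _ _)).trans hN
  have hNr : (20:ℝ) ≤ N := by exact_mod_cast hNc
  have hq0 : 0 < δ * ε := mul_pos hδ hε
  have hq1 : δ * ε < 1 := by nlinarith
  set q := δ * ε with hq
  set r := L / q with hr
  have hrq : r * q = L := by rw [hr]; field_simp
  have hr1 : 1 ≤ r := by rw [hr, le_div_iff₀ hq0]; linarith
  have hrinv : 1 / q ≤ r := by rw [hr]; gcongr
  have hA0 : (0:ℝ) ≤ 10 ^ 15 * r ^ 2 := by positivity
  have hA1 : (1:ℝ) ≤ Real.exp (10 ^ 15 * r ^ 2) := Real.one_le_exp hA0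
  by_cases hreg : (N:ℝ) ≤ 10 ^ 15 * r ^ 2
  · refine finish Finset.univ ⟨fun _ => true, Finset.mem_univ _⟩ (pad_good (by omega) (Finset.subset_univ _)) ?_ ?_
    · have : (fun ω => Fe κ (up (Finset.univ : Finset (Cube N)) ω)) = fun _ => (1:ℝ) := by
        funext ω
        unfold Fe
        rw [if_pos (full_mem hNb _ (fun x => by simp [up]))]
      rw [this, Ex_one]; linarith
    · simp only [Finset.card_univ, Fintype.card_fun, Fintype.card_bool, Fintype.card_fin, Nat.cast_pow, Nat.cast_ofNat]
      calc (2:ℝ) ^ N ≤ (Real.exp 1) ^ N := by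
            gcongr
            linarith [Real.add_one_le_exp 1]
        _ = Real.exp N := by rw [← Real.exp_nat_mul]; simp
        _ ≤ _ := Real.exp_le_exp.2 hreg
  push Not at hreg
  have hqN : 1 / (N:ℝ) ≤ q := by
    rw [div_le_iff₀ (by linarith)]
    rw [div_le_iff₀ hq0] at hrinv
    nlinarith
  have hδN : 1 / (N:ℝ) ≤ δ := hqN.trans (by nlinarith)
  have hεN : 1 / (N:ℝ) ≤ ε := hqN.trans (by nlinarith)
  have hbig : 1 - δ ≤ Ex p (Fe (N := N) κ) → ∀ T : Finset (Cube N), 1 - δ ≤ Ex p (fun ω => Fe κ (up T ω)) := by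
    intro h T
    exact h.trans (Ex_mono hp.le hp1 fun ω => Fe_mono (le_up T ω))
  by_cases hpl : (N:ℝ) ^ 4 ≤ 2 ^ N * p
  · refine finish {fun _ => true} (Finset.singleton_nonempty _) (single_good _) (hbig (hN1 N hNa p δ hp.le hp1 hpl hδN) _) ?_
    simpa using hA1
  push Not at hpl
  have hphalf : p ≤ 1 / 2 := by
    have h1 : 2 * (N:ℝ) ^ 4 ≤ 2 ^ N := by exact_mod_cast pow4 N hNc
    have h2 : (0:ℝ) < 2 ^ N := by positivity
    have h3 : 2 ^ N * p ≤ 2 ^ N * (1 / 2) := by linarith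
    exact le_of_mul_le_mul_left h3 h2
  set k := ⌈1000 * r⌉₊ with hk
  have hk1 : 1000 * r ≤ k := Nat.le_ceil _
  have hk2 : (k:ℝ) ≤ 1001 * r := by
    have := Nat.ceil_lt_add_one (show 0 ≤ 1000 * r by linarith)
    rw [← hk] at this; linarith
  have hkq : 1000 * L ≤ k * q := by rw [← hrq]; nlinarith
  set M := 2 ^ (50 * k ^ 2) with hM
  have hMexp : (M:ℝ) ≤ Real.exp (10 ^ 8 * r ^ 2) := by
    rw [hM]; push_cast
    calc (2:ℝ) ^ (50 * k ^ 2) ≤ (Real.exp 1) ^ (50 * k ^ 2) := by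
          gcongr
          linarith [Real.add_one_le_exp 1]
      _ = Real.exp (50 * k ^ 2) := by rw [← Real.exp_nat_mul]; simp
      _ ≤ _ := by
        refine Real.exp_le_exp.2 ?_
        have : (k:ℝ) ^ 2 ≤ (1001 * r) ^ 2 := by gcongr
        nlinarith
  have hM2 : 2 ≤ M := by
    rw [hM]
    have hk0 : 0 < k := by
      have : (0:ℝ) < k := by linarith
      exact_mod_cast this
    calc 2 = 2 ^ 1 := rfl
      _ ≤ _ := Nat.pow_le_pow_right (by norm_num) (Nat.succ_le_of_lt (by positivity))
  have hM2r : (2:ℝ) ≤ M := by exact_mod_cast hM2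
  have hMA : (M:ℝ) ≤ Real.exp (10 ^ 15 * r ^ 2) := hMexp.trans (Real.exp_le_exp.2 (by nlinarith [sq_nonneg r]))
  have hl1 : 1 ≤ Real.log N := by
    rw [Real.le_log_iff_exp_le (by linarith)]
    linarith [Real.exp_one_lt_d9]
  by_cases hMN : (M:ℝ) ^ 2 * Real.log N ≤ N
  · have hMleN : (M:ℝ) ≤ N := by nlinarith
    obtain ⟨T, hT1, hT2, hT3⟩ := thmH hp hphalf (Fe (N := N) κ) Fe_mono Fe01 k ε δ hε hδ hδ1 hε1.le hEf
      (by linarith) (by linarith) BadT (by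
        refine (bad_sum M (by omega) hMN hp.le hpl.le).trans ?_
        have h1 : (M + 1) * (2 / (N:ℝ) ^ 5) ≤ 1 / N / 4 := by
          exact num1 hNr hMleN
        linarith)
    rcases T.eq_empty_or_nonempty with rfl | hne
    · refine finish {fun _ => true} (Finset.singleton_nonempty _) (single_good _) (hT3.trans (boost_mono hp.le hp1 (Finset.empty_subset _))) ?_
      simpa using hA1
    · exact finish T hne hT1 hT3 (le_trans (by exact_mod_cast hT2) hMA)
  · push Not at hMN
    have hN4 : (N:ℝ) ≤ 4 * (M:ℝ) ^ 4 := by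
      have hs : Real.sqrt N ^ 2 = N := Real.sq_sqrt (by linarith)
      have hs0 : 0 < Real.sqrt N := Real.sqrt_pos.2 (by linarith)
      have h1 : Real.log N ≤ 2 * Real.sqrt N := by
        have h2 := Real.log_le_sub_one_of_pos hs0
        rw [Real.log_sqrt (by linarith)] at h2
        linarith
      have h3 : Real.sqrt N * Real.sqrt N ≤ (2 * (M:ℝ) ^ 2) * Real.sqrt N := by
        have : (M:ℝ) ^ 2 * Real.log N ≤ (M:ℝ) ^ 2 * (2 * Real.sqrt N) := by gcongr
        nlinarith
      have h4 := le_of_mul_le_mul_right h3 hs0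
      rw [← hs]
      calc Real.sqrt N ^ 2 ≤ (2 * (M:ℝ) ^ 2) ^ 2 := by gcongr
        _ = _ := by ring
    obtain ⟨T, hT1, hT2, hT3⟩ := thmH hp hphalf (Fe (N := N) κ) Fe_mono Fe01 k ε δ hε hδ hδ1 hε1.le hEf
      (by linarith) (by linarith) (fun _ => False) (by simp; linarith)
    refine finish (T ∪ S0 N) ⟨fun _ => true, Finset.mem_union_right _ (Finset.mem_insert_self _ _)⟩
      (pad_good (by omega) Finset.subset_union_right) (hT3.trans (boost_mono hp.le hp1 Finset.subset_union_left)) ?_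
    have hc : (T ∪ S0 N).card ≤ M + (N + 1) := (Finset.card_union_le _ _).trans (add_le_add hT2 S0_card)
    have hc' : ((T ∪ S0 N).card : ℝ) ≤ M + (N + 1) := by exact_mod_cast hc
    refine hc'.trans ?_
    have h5 : (M:ℝ) ≤ M ^ 4 := le_self_pow₀ (by linarith) (by norm_num)
    have h6 : (2:ℝ) ^ 4 ≤ M ^ 4 := by gcongr
    calc (M:ℝ) + (N + 1) ≤ M ^ 4 * M ^ 4 := by nlinarith
      _ = M ^ 8 := by ring
      _ ≤ Real.exp (10 ^ 8 * r ^ 2) ^ 8 := by gcongr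
      _ = Real.exp (8 * (10 ^ 8 * r ^ 2)) := by rw [← Real.exp_nat_mul]; norm_num
      _ ≤ _ := Real.exp_le_exp.2 (by nlinarith [sq_nonneg r])
end fin

/-- There is an absolute constant `C₂ > 0` such that for every `κ`, all `N`
sufficiently large, any `ε_N ∈ [(log log N)^{-1/10}, 1)`, and any `δ ∈ (0,1)`,
there exists an admissible tuple `(x_1, …, x_m) ∈ Σ_N^m` (of some length
`m ≥ 1`) whose underlying set is a `(1-δ)`-boosting set at parameter `p*`,
with `m ≤ exp(10^{15} (δ ε_N)^{-2} (log log N)^{1/5})`. -/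
theorem admissible_boosting_set_exists :
    ∃ C₂ > (0 : ℝ), ∀ κ : ℝ, ∃ N₀ : ℕ, ∀ N : ℕ, N₀ ≤ N →
      ∀ εN δ pN : ℝ,
        Real.log (Real.log N) ^ (-(1 : ℝ) / 10) ≤ εN → εN < 1 →
        0 < δ → δ < 1 →
        0 ≤ pN → pN ≤ 1 →
        bernoulliP pN (emptyInter (N := N) κ) = εN →
        ∃ m : ℕ, ∃ X : Fin (m + 1) → Cube N,
          Admissible C₂ X ∧
          PerceptronBoosting κ (pStar (N := N) κ pN) δ (Finset.image X Finset.univ) ∧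
          ((m : ℝ) + 1) ≤
            Real.exp (10 ^ 15 * (δ * εN) ^ (-2 : ℝ) *
              Real.log (Real.log N) ^ ((1 : ℝ) / 5)) := by
  refine ⟨10, by norm_num, fun κ => ?_⟩
  obtain ⟨N1, hN1⟩ := core_exists κ
  obtain ⟨N2, hN2⟩ := exists_nat_gt (κ ^ 2)
  obtain ⟨N3, hN3⟩ := exists_nat_ge (Real.exp (Real.exp 1))
  refine ⟨max N1 (max N2 N3), fun N hN εN δ pN hε0 hε1 hδ hδ1 h0 h1 hE => ?_⟩
  have hNa : N1 ≤ N := (le_max_left _ _).trans hN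
  have hNb : κ ^ 2 < N := lt_of_lt_of_le hN2 (by exact_mod_cast ((le_max_left _ _).trans (le_max_right _ _)).trans hN)
  have hNc : Real.exp (Real.exp 1) ≤ N := hN3.trans (by exact_mod_cast ((le_max_right _ _).trans (le_max_right _ _)).trans hN)
  have hNp : (0:ℝ) < N := lt_of_lt_of_le (Real.exp_pos _) hNc
  have hl1 : Real.exp 1 ≤ Real.log N := by rwa [Real.le_log_iff_exp_le hNp]
  have hlp : 0 < Real.log N := lt_of_lt_of_le (Real.exp_pos _) hl1
  have hl2 : 1 ≤ Real.log (Real.log N) := by rwa [Real.le_log_iff_exp_le hlp]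
  set l := Real.log (Real.log N) with hl
  have hL : 1 ≤ l ^ ((1:ℝ) / 10) := Real.one_le_rpow hl2 (by norm_num)
  have hε : 0 < εN := lt_of_lt_of_le (Real.rpow_pos_of_pos (by linarith) _) hε0
  obtain ⟨p0, p1, pE, pI⟩ := pStar_facts hNb pN εN (l ^ ((1:ℝ) / 10)) rfl (by linarith) h0 h1 hε hε1 hE
  have := hN1 N hNa (pStar (N := N) κ pN) δ εN _ hL hε hε1 hδ hδ1 p0 p1 pE pI
  have e : (10:ℝ) ^ 15 * (δ * εN) ^ (-2 : ℝ) * l ^ ((1 : ℝ) / 5) = 10 ^ 15 * (l ^ ((1:ℝ) / 10) / (δ * εN)) ^ 2 := by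
    have e1 : l ^ ((1 : ℝ) / 5) = (l ^ ((1:ℝ) / 10)) ^ 2 := by
      rw [← Real.rpow_natCast (l ^ ((1:ℝ) / 10)) 2, ← Real.rpow_mul (by linarith)]; norm_num
    have e2 : (δ * εN) ^ (-2 : ℝ) = ((δ * εN) ^ 2)⁻¹ := by
      rw [Real.rpow_neg (by positivity)]; norm_num
    rw [e1, e2, div_pow]; ring
  rw [e]; exact this
end
end

section
/- Let k ≥ 1 and let X = (x_1,…,x_k) ∈ Σ_N^k be admissible. Then there exists a gentle mapping f = (f_1,…,f_k) : Σ_N^k → Σ_N^k such that for every admissible Y ∈ Σ_N^k there exist a permutation σ ∈ S_N and g ∈ Σ_N with g∘(σ∘f(Y)) = X. -/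
open scoped Classical

noncomputable section

/-- The record `φ_I(Y) = (I_a(Y))_{a ∈ {-1,1}^k}`. -/
def phiI {N k : ℕ} (Y : Fin (k + 1) → Cube N) : (Fin k → Bool) → Set (Fin N) :=
  fun a => Ia Y a

/-- The label-exchanging action of `σ ∈ S_N` on `x ∈ Σ_N`:
`(σ∘x)^i = x^{σ^{-1}(i)}`. -/
def permAct {N : ℕ} (σ : Equiv.Perm (Fin N)) (x : Cube N) : Cube N :=
  fun i => x (σ.symm i)

/-- A mapping `f = (f_1, …, f_{k+1}) : Σ_N^{k+1} → Σ_N^{k+1}` is gentle (with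
constant `C₂`) if it commutes with every sign switch `g ∈ Σ_N` (acting
componentwise) and moves each coordinate vector by Hamming distance at most
`2^{k+1} C₂ (N log N)^{1/2}`. -/
def Gentle {N k : ℕ} (C₂ : ℝ)
    (f : (Fin (k + 1) → Cube N) → (Fin (k + 1) → Cube N)) : Prop :=
  (∀ g : Cube N, ∀ Y : Fin (k + 1) → Cube N,
      f (fun i => signSwitch g (Y i)) = fun i => signSwitch g (f Y i)) ∧
    ∀ Y : Fin (k + 1) → Cube N, ∀ i : Fin (k + 1),
      (hammingDist (Y i) (f Y i) : ℝ) ≤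
        2 ^ (k + 1) * C₂ * Real.sqrt (N * Real.log N)

theorem exists_perm_aux {α β : Type*} [Fintype α] [Fintype β] (p q : α → β) :
    ∃ σ : Equiv.Perm α, (Finset.univ.filter fun j => p j ≠ q (σ j)).card ≤
      ∑ a : β, ((Finset.univ.filter fun j => p j = a).card
        - (Finset.univ.filter fun j => q j = a).card) := by
  have h1 : ∀ a : β, ∃ S : Finset α, ∃ f : α → α, (∀ j ∈ S, p j = a) ∧
      (∀ j ∈ S, q (f j) = a) ∧ Set.InjOn f S ∧
      ((Finset.univ.filter fun j => p j = a) \ S).card ≤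
      ((Finset.univ.filter fun j => p j = a).card
        - (Finset.univ.filter fun j => q j = a).card) := by
    intro a
    set P := Finset.univ.filter fun j => p j = a with hP
    set Q := Finset.univ.filter fun j => q j = a with hQ
    obtain ⟨S, hSP, hS⟩ := Finset.exists_subset_card_eq (min_le_left P.card Q.card)
    obtain ⟨T, hTQ, hT⟩ := Finset.exists_subset_card_eq (min_le_right P.card Q.card)
    have e : S ≃ T := Finset.equivOfCardEq (hS.trans hT.symm)
    refine ⟨S, fun j => if h : j ∈ S then (e ⟨j, h⟩ : α) else j, ?_, ?_, ?_, ?_⟩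
    · intro j hj
      have := hSP hj
      simpa [hP] using this
    · intro j hj
      have := hTQ (e ⟨j, hj⟩).2
      simpa [hQ, hj] using this
    · intro x hx y hy hxy
      have hx' : x ∈ S := hx
      have hy' : y ∈ S := hy
      simp only [hx', hy', dif_pos] at hxy
      have := e.injective (Subtype.ext hxy)
      simpa using this
    · rw [Finset.card_sdiff_of_subset hSP, hS]
      omega
  choose S f hp hq hinj hc using h1
  have hinj' : Set.InjOn (fun j => f (p j) j) {j | j ∈ S (p j)} := by
    intro x hx y hy hxy
    simp only [Set.mem_ofPred_eq] at hx hy hxy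
    have h : p x = p y := by rw [← hq _ _ hx, ← hq _ _ hy, hxy]
    rw [← h] at hy hxy
    exact hinj _ hx hy hxy
  obtain ⟨g, hg⟩ := Set.MapsTo.exists_equiv_extend_of_card_eq (t := (Finset.univ : Finset α))
    (by simp) (s := {j | j ∈ S (p j)}) (f := fun j => f (p j) j) (by intro j _; simp) hinj'
  refine ⟨g.trans (Equiv.subtypeUnivEquiv (by simp)), ?_⟩
  rw [Finset.card_eq_sum_card_fiberwise (f := p) (t := Finset.univ) (by intro j _; simp)]
  refine Finset.sum_le_sum fun a _ => le_trans (Finset.card_le_card ?_) (hc a)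
  intro j hj
  simp only [Finset.mem_filter, Finset.mem_univ, true_and, Finset.mem_sdiff] at hj ⊢
  refine ⟨hj.2, fun hjS => hj.1 ?_⟩
  obtain ⟨hj1, rfl⟩ := hj
  have := hg j hjS
  simp [Equiv.subtypeUnivEquiv, this, hq _ _ hjS]

/-- The pattern at each position. -/
def pat {N k : ℕ} (Y : Fin (k + 1) → Cube N) : Fin N → Fin k → Bool :=
  fun j i => Y 0 j == Y i.succ j

theorem ncard_Ia {N k : ℕ} (Y : Fin (k + 1) → Cube N) (a : Fin k → Bool) :
    (Ia Y a).ncard = (Finset.univ.filter fun j => pat Y j = a).card := by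
  rw [← Set.ncard_coe_finset]
  congr 1
  ext j
  simp [Ia, pat, signSwitch, funext_iff]

theorem exists_pat {N k : ℕ} (C₂ : ℝ) (hC₂ : 0 < C₂)
    (X : Fin (k + 1) → Cube N) (hX : Admissible C₂ X) (p : Fin N → Fin k → Bool) :
    ∃ r : Fin N → Fin k → Bool,
      ((Finset.univ.filter fun j => p j ≠ r j).card : ℝ) ≤
        2 ^ (k + 1) * C₂ * Real.sqrt (N * Real.log N) ∧
      ((∀ a : Fin k → Bool, |((Finset.univ.filter fun j => p j = a).card : ℝ) -
        (2 : ℝ) ^ (-(k : ℝ)) * N| ≤ C₂ * Real.sqrt (N * Real.log N)) →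
        ∃ σ : Equiv.Perm (Fin N), ∀ j, r j = pat X (σ j)) := by
  by_cases h : (∀ a : Fin k → Bool, |((Finset.univ.filter fun j => p j = a).card : ℝ) -
        (2 : ℝ) ^ (-(k : ℝ)) * N| ≤ C₂ * Real.sqrt (N * Real.log N))
  · obtain ⟨σ, hσ⟩ := exists_perm_aux p (pat X)
    refine ⟨fun j => pat X (σ j), ?_, fun _ => ⟨σ, fun _ => rfl⟩⟩
    have hσ' : (Finset.univ.filter fun j => p j ≠ pat X (σ j)).card ≤
      ∑ a : Fin k → Bool, ((Finset.univ.filter fun j => p j = a).card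
        - (Finset.univ.filter fun j => pat X j = a).card) := by
      convert hσ
    refine le_trans (Nat.cast_le.mpr hσ') ?_
    rw [Nat.cast_sum]
    refine le_trans (Finset.sum_le_card_nsmul _ _ (2 * (C₂ * Real.sqrt (N * Real.log N))) ?_) ?_
    · intro a _
      have h1 := abs_le.mp (h a)
      have h2 := hX a
      rw [ncard_Ia] at h2
      have h2 := abs_le.mp h2
      have h0 : 0 ≤ C₂ * Real.sqrt (N * Real.log N) := by positivity
      rcases le_total (Finset.univ.filter fun j => pat X j = a).card
        (Finset.univ.filter fun j => p j = a).card with hle | hle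
      · rw [Nat.cast_sub hle]; linarith
      · rw [Nat.sub_eq_zero_of_le hle]; push_cast; linarith
    · apply le_of_eq
      simp [pow_succ]
      ring
  · exact ⟨p, by simp; positivity, fun h' => absurd h' h⟩

/-- Let `X ∈ Σ_N^{k+1}` be admissible. Then there is a gentle mapping `f` such
that every admissible `Y ∈ Σ_N^{k+1}` satisfies `g ∘ (σ ∘ f(Y)) = X` for some
permutation `σ ∈ S_N` and some sign switch `g ∈ Σ_N`. -/
theorem gentle_map_exists (N k : ℕ) (C₂ : ℝ) (hC₂ : 0 < C₂)
    (X : Fin (k + 1) → Cube N) (hX : Admissible C₂ X) :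
    ∃ f : (Fin (k + 1) → Cube N) → (Fin (k + 1) → Cube N),
      Gentle C₂ f ∧
        ∀ Y : Fin (k + 1) → Cube N, Admissible C₂ Y →
          ∃ σ : Equiv.Perm (Fin N), ∃ g : Cube N,
            (fun i => signSwitch g (permAct σ (f Y i))) = X := by
  choose F hF1 hF2 using exists_pat C₂ hC₂ X hX
  have hpat : ∀ (g : Cube N) (Y : Fin (k + 1) → Cube N),
      pat (fun i => signSwitch g (Y i)) = pat Y := by
    intro g Y
    funext j i
    simp only [pat, signSwitch]
    cases g j <;> cases Y 0 j <;> cases Y i.succ j <;> rfl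
  refine ⟨fun Y => Fin.cons (Y 0) fun i j => Y 0 j == F (pat Y) j i, ⟨?_, ?_⟩, ?_⟩
  · intro g Y
    simp only [hpat]
    funext i j
    refine Fin.cases ?_ (fun i => ?_) i
    · simp
    · simp only [Fin.cons_succ, signSwitch]
      cases g j <;> cases Y 0 j <;> cases F (pat Y) j i <;> rfl
  · intro Y i
    refine le_trans (Nat.cast_le.mpr ?_) (hF1 (pat Y))
    unfold hammingDist
    refine Finset.card_le_card fun j => ?_
    simp only [Finset.mem_filter, Finset.mem_univ, true_and]
    refine Fin.cases ?_ (fun i => ?_) i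
    · simp
    · simp only [Fin.cons_succ]
      intro hne heq
      apply hne
      rw [← heq]
      simp only [pat]
      cases Y 0 j <;> cases Y i.succ j <;> rfl
  · intro Y hY
    obtain ⟨σ, hσ⟩ := hF2 (pat Y) (fun a => by rw [← ncard_Ia]; exact hY a)
    refine ⟨σ, fun j => Y 0 (σ.symm j) == X 0 j, ?_⟩
    funext i j
    refine Fin.cases ?_ (fun i => ?_) i
    · simp only [Fin.cons_zero, signSwitch, permAct]
      cases Y 0 (σ.symm j) <;> cases X 0 j <;> rfl
    · simp only [Fin.cons_succ, signSwitch, permAct, hσ, Equiv.apply_symm_apply, pat]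
      cases Y 0 (σ.symm j) <;> cases X 0 j <;> cases X i.succ j <;> rfl
end
end
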